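/- arXiv:2601.09471 — 2 statements merged into one kernel-verified Lean document; each statement's English description precedes it below -/
import Mathlib

section
/- Consider the linear time-varying system ẋ(t) = A x(t) + Ω(t)ᵀ z(t), ż(t) = −Λ Ω(t) P x(t), where x(t) ∈ ℝⁿ, z(t) ∈ ℝᵖ, A ∈ ℝ^{n×n} is Hurwitz, P ∈ ℝ^{n×n} is symmetric positive definite and satisfies Aᵀ P + P A = −Q for some symmetric positive definite Q, and Λ ∈ ℝ^{p×p} is symmetric positive definite. If Ω : [t₀,∞) → ℝ^{p×n} is continuously differentiable, ‖Ω(t)‖ and ‖Ω̇(t)‖ are uniformly bounded on [t₀,∞), and Ω is persistently exciting, then the origin of the system is exponentially stable: there exist constants k > 0 and λ > 0 such that every solution satisfies ‖(x(t), z(t))‖ ≤ k e^{−λ(t−s)} ‖(x(s), z(s))‖ for all t ≥ s ≥ t₀. -/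
open Matrix Filter Topology

/-- Induced 2-norm (operator norm w.r.t. Euclidean norms) of a real matrix. -/
noncomputable def opNorm {m n : Type*} [Fintype m] [Fintype n] [DecidableEq n]
    (A : Matrix m n ℝ) : ℝ :=
  ‖LinearMap.toContinuousLinearMap (Matrix.toEuclideanLin A)‖

/-- A real square matrix is Hurwitz if all of its complex eigenvalues have
negative real part. -/
def Hurwitz {n : Type*} [Fintype n] [DecidableEq n] (A : Matrix n n ℝ) : Prop :=
  ∀ μ ∈ spectrum ℂ (A.map (algebraMap ℝ ℂ)), μ.re < 0

/-- A matrix-valued function `W` on `[t₀, ∞)` is persistently exciting: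
`∫_t^{t+T₀} W(τ) W(τ)ᵀ dτ ⪰ a I` for all `t ≥ t₀`. -/
def IsPEMat {p n : ℕ} (t₀ : ℝ) (W : ℝ → Matrix (Fin p) (Fin n) ℝ) : Prop :=
  ∃ a > (0:ℝ), ∃ T₀ > (0:ℝ), ∀ t ≥ t₀,
    ((Matrix.of fun i j => ∫ τ in t..(t + T₀), (W τ * (W τ)ᵀ) i j)
      - a • (1 : Matrix (Fin p) (Fin p) ℝ)).PosSemidef

theorem le_mul_exp_of_hasDerivAt_le {t₀ μ : ℝ} {W W' : ℝ → ℝ}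
    (hW : ∀ t ≥ t₀, HasDerivAt W (W' t) t) (hle : ∀ t ≥ t₀, W' t ≤ -μ * W t)
    {s t : ℝ} (hs : t₀ ≤ s) (hst : s ≤ t) : W t ≤ Real.exp (-μ * (t - s)) * W s := by
  have hd : ∀ u ≥ t₀, HasDerivAt (fun u => Real.exp (μ * u) * W u)
      (Real.exp (μ * u) * μ * W u + Real.exp (μ * u) * W' u) u := fun u hu => by
    have h1 : HasDerivAt (fun u => Real.exp (μ * u)) (Real.exp (μ * u) * μ) u := by
      simpa using ((hasDerivAt_id u).const_mul μ).exp
    exact h1.mul (hW u hu)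
  have hanti : AntitoneOn (fun u => Real.exp (μ * u) * W u) (Set.Ici t₀) := by
    refine antitoneOn_of_deriv_nonpos (convex_Ici t₀)
      (fun u hu => (hd u hu).continuousAt.continuousWithinAt)
      (fun u hu => (hd u (interior_subset hu)).differentiableAt.differentiableWithinAt)
      fun u hu => ?_
    rw [(hd u (interior_subset hu)).deriv]
    nlinarith [hle u (interior_subset hu), Real.exp_pos (μ * u)]
  have h := hanti (Set.mem_Ici.2 hs) (Set.mem_Ici.2 (hs.trans hst)) hst
  have he : Real.exp (-μ * (t - s)) = Real.exp (μ * s) * (Real.exp (μ * t))⁻¹ := by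
    rw [← Real.exp_neg, ← Real.exp_add]; ring_nf
  rw [he]
  have hp := Real.exp_pos (μ * t)
  simp only at h
  calc W t = (Real.exp (μ * t))⁻¹ * (Real.exp (μ * t) * W t) := by field_simp
    _ ≤ (Real.exp (μ * t))⁻¹ * (Real.exp (μ * s) * W s) := by gcongr
    _ = _ := by ring

/-- A differentiable, uniformly bounded function whose derivative compares the sliding integral
of `M` with the current value of `M`. -/
theorem exists_hasDerivAt_window_integral {H : Type*} [NormedAddCommGroup H] [NormedSpace ℝ H]
    [CompleteSpace H] {M : ℝ → H} (hM : Continuous M) {B T : ℝ} (hB : ∀ t, ‖M t‖ ≤ B)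
    (hT : 0 ≤ T) :
    ∃ S : ℝ → H, (∀ t, HasDerivAt S ((∫ τ in t..(t + T), M τ) - T • M t) t) ∧
      ∀ t, ‖S t‖ ≤ B * T * T := by
  have hi : ∀ a b, IntervalIntegrable M MeasureTheory.volume a b := hM.intervalIntegrable
  let F : ℝ → H := fun t => ∫ τ in (0 : ℝ)..t, M τ
  have hF : ∀ t, HasDerivAt F (M t) t := fun t => hM.integral_hasStrictDerivAt 0 t |>.hasDerivAt
  have hFc : Continuous F := continuous_iff_continuousAt.2 fun t => (hF t).continuousAt
  let I : ℝ → H := fun t => ∫ τ in (0 : ℝ)..t, F τ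
  have hI : ∀ t, HasDerivAt I (F t) t := fun t => hFc.integral_hasStrictDerivAt 0 t |>.hasDerivAt
  refine ⟨fun t => I (t + T) - I t - T • F t, fun t => ?_, fun t => ?_⟩
  · have h := (((hI (t + T)).comp_add_const t T).sub (hI t)).sub ((hF t).const_smul T)
    rwa [show F (t + T) - F t = ∫ τ in t..(t + T), M τ from
      intervalIntegral.integral_interval_sub_left (hi _ _) (hi _ _)] at h
  · have h1 : I (t + T) - I t - T • F t = ∫ τ in t..(t + T), (F τ - F t) := by
      rw [intervalIntegral.integral_sub (hFc.intervalIntegrable _ _)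
        intervalIntegrable_const, intervalIntegral.integral_const, add_sub_cancel_left]
      congr 1
      exact intervalIntegral.integral_interval_sub_left (hFc.intervalIntegrable _ _)
        (hFc.intervalIntegrable _ _)
    have hB0 : 0 ≤ B := (norm_nonneg _).trans (hB 0)
    have h2 : ‖∫ τ in t..(t + T), (F τ - F t)‖ ≤ B * T * |t + T - t| := by
      refine intervalIntegral.norm_integral_le_of_norm_le_const fun τ hτ => ?_
      rw [Set.uIoc_of_le (by linarith)] at hτ
      have h3 : F τ - F t = ∫ σ in t..τ, M σ :=
        intervalIntegral.integral_interval_sub_left (hi _ _) (hi _ _)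
      rw [h3]
      refine (intervalIntegral.norm_integral_le_of_norm_le_const fun σ _ => hB σ).trans ?_
      rw [abs_of_pos (by linarith [hτ.1])]
      gcongr
      linarith [hτ.2]
    simp only [h1]
    simpa [abs_of_nonneg hT] using h2

theorem exists_pos_mul_sq_le_inner {n : ℕ} {M : Matrix (Fin n) (Fin n) ℝ} (hM : M.PosDef) :
    ∃ c > (0 : ℝ), ∀ x : EuclideanSpace ℝ (Fin n),
      c * ‖x‖ ^ 2 ≤ inner ℝ (Matrix.toEuclideanLin M x) x := by
  have hpos : ∀ x : EuclideanSpace ℝ (Fin n), x ≠ 0 →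
      0 < inner ℝ (Matrix.toEuclideanLin M x) x := fun x hx => by
    have h := hM.dotProduct_mulVec_pos (x := WithLp.ofLp x) (by simpa using hx)
    simpa [EuclideanSpace.inner_eq_star_dotProduct, Matrix.toLpLin_apply] using h
  have hcont : Continuous fun x : EuclideanSpace ℝ (Fin n) =>
      inner ℝ (Matrix.toEuclideanLin M x) x :=
    (LinearMap.continuous_of_finiteDimensional (Matrix.toEuclideanLin M)).inner continuous_id
  rcases (Metric.sphere (0 : EuclideanSpace ℝ (Fin n)) 1).eq_empty_or_nonempty with he | hne
  · refine ⟨1, one_pos, fun x => ?_⟩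
    have hx : x = 0 := by
      by_contra hx
      have : (‖x‖⁻¹ • x) ∈ Metric.sphere (0 : EuclideanSpace ℝ (Fin n)) 1 := by
        simp [norm_smul, hx]
      simp [he] at this
    simp [hx]
  · obtain ⟨y, hy, hmin⟩ := (isCompact_sphere (0 : EuclideanSpace ℝ (Fin n)) 1).exists_isMinOn
      hne hcont.continuousOn
    have hy0 : y ≠ 0 := by rintro rfl; simp at hy
    refine ⟨_, hpos y hy0, fun x => ?_⟩
    by_cases hx : x = 0
    · simp [hx]
    have hx' : (‖x‖⁻¹ • x) ∈ Metric.sphere (0 : EuclideanSpace ℝ (Fin n)) 1 := by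
      simp [norm_smul, hx]
    have h := isMinOn_iff.1 hmin _ hx'
    simp only [map_smul, inner_smul_left, inner_smul_right, RCLike.conj_to_real] at h
    have hn : 0 < ‖x‖ := norm_pos_iff.2 hx
    calc _ ≤ (‖x‖⁻¹ * (‖x‖⁻¹ * inner ℝ (Matrix.toEuclideanLin M x) x)) * ‖x‖ ^ 2 := by gcongr
      _ = _ := by field_simp

theorem sqrt_le_exp_of_quadratic_lyapunov {t₀ c₁ c₂ c₃ : ℝ} (hc₁ : 0 < c₁) (hc₂ : 0 < c₂)
    (hc₃ : 0 < c₃) {N W W' : ℝ → ℝ} (hW : ∀ t ≥ t₀, HasDerivAt W (W' t) t)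
    (hlow : ∀ t ≥ t₀, c₁ * N t ≤ W t) (hup : ∀ t ≥ t₀, W t ≤ c₂ * N t)
    (hdec : ∀ t ≥ t₀, W' t ≤ -(c₃ * N t)) {s t : ℝ} (hs : t₀ ≤ s) (hst : s ≤ t) :
    Real.sqrt (N t) ≤
      Real.sqrt (c₂ / c₁) * Real.exp (-(c₃ / (2 * c₂)) * (t - s)) * Real.sqrt (N s) := by
  have h := le_mul_exp_of_hasDerivAt_le (μ := c₃ / c₂) hW (fun u hu => by
    refine (hdec u hu).trans ?_
    rw [neg_mul, neg_le_neg_iff]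
    calc c₃ / c₂ * W u ≤ c₃ / c₂ * (c₂ * N u) := by gcongr; exact hup u hu
      _ = c₃ * N u := by field_simp) hs hst
  have hexp : Real.exp (-(c₃ / c₂) * (t - s)) =
      Real.exp (-(c₃ / (2 * c₂)) * (t - s)) ^ 2 := by
    rw [← Real.exp_nat_mul]; congr 1; push_cast; field_simp
  have hN : N t ≤ c₂ / c₁ * Real.exp (-(c₃ / (2 * c₂)) * (t - s)) ^ 2 * N s := by
    rw [← hexp]
    calc N t = (c₁ * N t) / c₁ := by field_simp
      _ ≤ (Real.exp (-(c₃ / c₂) * (t - s)) * (c₂ * N s)) / c₁ := by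
        refine div_le_div_of_nonneg_right ?_ hc₁.le
        refine ((hlow t (hs.trans hst)).trans h).trans ?_
        gcongr
        exact hup s hs
      _ = _ := by ring
  refine (Real.sqrt_le_sqrt hN).trans (le_of_eq ?_)
  rw [Real.sqrt_mul (by positivity), Real.sqrt_mul (by positivity),
    Real.sqrt_sq (Real.exp_pos _).le]

theorem exists_pos_mul_le_and_mul_le {u v b c : ℝ} (hu : 0 ≤ u) (hv : 0 ≤ v) (hb : 0 < b)
    (hc : 0 < c) : ∃ ε > 0, ε * u ≤ b ∧ ε * v ≤ c := by
  refine ⟨min (b / (u + 1)) (c / (v + 1)), lt_min (by positivity) (by positivity), ?_, ?_⟩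
  · calc _ ≤ b / (u + 1) * (u + 1) :=
          mul_le_mul (min_le_left _ _) (by linarith) hu (by positivity)
      _ = b := by field_simp
  · calc _ ≤ c / (v + 1) * (v + 1) :=
          mul_le_mul (min_le_right _ _) (by linarith) hv (by positivity)
      _ = c := by field_simp

set_option maxHeartbeats 1000000 in
theorem exponentially_stable_of_persistentlyExciting {E G : Type*}
    [NormedAddCommGroup E] [InnerProductSpace ℝ E] [CompleteSpace E]
    [NormedAddCommGroup G] [InnerProductSpace ℝ G] [CompleteSpace G]
    {t₀ : ℝ} (A P : E →L[ℝ] E) (L K : G →L[ℝ] G) {q mP mK C a T : ℝ}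
    (hPsymm : ∀ x y, inner ℝ (P x) y = inner ℝ x (P y))
    (hKsymm : ∀ x y, inner ℝ (K x) y = inner ℝ x (K y))
    (hKL : ∀ z, K (L z) = z)
    (hmP : 0 < mP) (hP : ∀ x, mP * ‖x‖ ^ 2 ≤ inner ℝ (P x) x)
    (hmK : 0 < mK) (hK : ∀ z, mK * ‖z‖ ^ 2 ≤ inner ℝ (K z) z)
    (hq : 0 < q) (hLyap : ∀ x, 2 * inner ℝ (P x) (A x) ≤ -(q * ‖x‖ ^ 2))
    (O O' : ℝ → E →L[ℝ] G) (hO : ∀ t ≥ t₀, HasDerivAt O (O' t) t)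
    (hOC : ∀ t ≥ t₀, ‖O t‖ ≤ C) (hO'C : ∀ t ≥ t₀, ‖O' t‖ ≤ C)
    (ha : 0 < a) (hT : 0 < T)
    (hPE : ∀ t ≥ t₀, ∀ z, a * ‖z‖ ^ 2 ≤ ∫ τ in t..(t + T), ‖(O τ).adjoint z‖ ^ 2) :
    ∃ k > (0 : ℝ), ∃ lam > (0 : ℝ), ∀ x : ℝ → E, ∀ z : ℝ → G,
      (∀ t ≥ t₀, HasDerivAt x (A (x t) + (O t).adjoint (z t)) t) →
      (∀ t ≥ t₀, HasDerivAt z (-(L (O t (P (x t))))) t) →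
      ∀ s ≥ t₀, ∀ t ≥ s, Real.sqrt (‖x t‖ ^ 2 + ‖z t‖ ^ 2) ≤
        k * Real.exp (-lam * (t - s)) * Real.sqrt (‖x s‖ ^ 2 + ‖z s‖ ^ 2) := by
  have hC : 0 ≤ C := (norm_nonneg _).trans (hOC t₀ le_rfl)
  -- The instantaneous excitation, extended continuously to the left of `t₀`.
  let M : ℝ → G →L[ℝ] G := fun t => O (max t t₀) ∘L (O (max t t₀)).adjoint
  have hOcont : Continuous fun t => O (max t t₀) := by
    refine continuous_iff_continuousAt.2 fun t => ?_
    exact ContinuousAt.comp (g := O) (hO _ (le_max_right _ _)).continuousAt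
      (continuous_id.max continuous_const).continuousAt
  have hMcont : Continuous M :=
    hOcont.clm_comp (ContinuousLinearMap.adjoint.continuous.comp hOcont)
  have hMB : ∀ t, ‖M t‖ ≤ C * C := fun t => by
    refine (ContinuousLinearMap.opNorm_comp_le _ _).trans ?_
    rw [LinearIsometryEquiv.norm_map]
    have := hOC (max t t₀) (le_max_right _ _)
    gcongr
  have hMinner : ∀ t ≥ t₀, ∀ w, inner ℝ (M t w) w = ‖(O t).adjoint w‖ ^ 2 := fun t ht w => by
    simp only [M, max_eq_left ht, ContinuousLinearMap.comp_apply]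
    rw [← ContinuousLinearMap.adjoint_inner_right, real_inner_self_eq_norm_sq]
  have hJ : ∀ t ≥ t₀, ∀ w, a * ‖w‖ ^ 2 ≤ inner ℝ ((∫ τ in t..(t + T), M τ) w) w := by
    intro t ht w
    refine (hPE t ht w).trans (le_of_eq ?_)
    let φ : (G →L[ℝ] G) →L[ℝ] ℝ := (innerSL ℝ w) ∘L (ContinuousLinearMap.apply ℝ G w)
    have h := φ.intervalIntegral_comp_comm (hMcont.intervalIntegrable (μ := MeasureTheory.volume)
      t (t + T))
    have h2 : ∀ N : G →L[ℝ] G, φ N = inner ℝ (N w) w := fun N => by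
      simp [φ, real_inner_comm]
    rw [← h2, ← h]
    refine intervalIntegral.integral_congr fun τ hτ => ?_
    rw [Set.uIcc_of_le (by linarith)] at hτ
    simp only [h2]
    exact (hMinner τ (ht.le.trans hτ.1) w).symm
  obtain ⟨S, hS, hSB⟩ := exists_hasDerivAt_window_integral hMcont hMB hT.le
  set R : ℝ := C * C * T * T with hR
  have hR0 : 0 ≤ R := by positivity
  -- Constants of the Lyapunov function.
  let C₁ : ℝ := T * (‖L‖ * C * ‖P‖ * C)
  let C₂ : ℝ := T * (C + C * ‖A‖) + 2 * (R * (‖L‖ * C * ‖P‖))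
  have hC₁ : 0 ≤ C₁ := by positivity
  have hC₂ : 0 ≤ C₂ := by positivity
  let m : ℝ := min mP mK
  have hm : 0 < m := lt_min hmP hmK
  let D : ℝ := T * C + R
  have hD : 0 ≤ D := by positivity
  obtain ⟨ε, hε, hε₁, hε₂⟩ : ∃ ε > (0 : ℝ), ε * (C₁ + C₂ ^ 2 / (2 * a)) ≤ q / 2 ∧
      ε * D ≤ m / 2 := by
    exact exists_pos_mul_le_and_mul_le (by positivity) hD (half_pos hq) (half_pos hm)
  let c₂ : ℝ := ‖P‖ + ‖K‖ + m
  let c₃ : ℝ := min (q / 2) (ε * a / 2)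
  have hc₂ : 0 < c₂ := by positivity
  have hc₃ : 0 < c₃ := lt_min (by positivity) (by positivity)
  refine ⟨Real.sqrt (c₂ / (m / 2)), Real.sqrt_pos.2 (by positivity), c₃ / (2 * c₂),
    by positivity, fun x z hx hz s hs t hst => ?_⟩
  let V : ℝ → ℝ := fun t => inner ℝ (P (x t)) (x t) + inner ℝ (K (z t)) (z t)
  let Y : ℝ → ℝ := fun t => -(T * inner ℝ (z t) (O t (x t))) - inner ℝ (S t (z t)) (z t)
  have hV : ∀ t ≥ t₀, ∃ v, HasDerivAt V v t ∧ v ≤ -(q * ‖x t‖ ^ 2) := by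
    intro t ht
    have h1 := ((P.hasFDerivAt.comp_hasDerivAt t (hx t ht)).inner ℝ (hx t ht))
    have h2 := ((K.hasFDerivAt.comp_hasDerivAt t (hz t ht)).inner ℝ (hz t ht))
    refine ⟨_, h1.add h2, ?_⟩
    refine le_of_eq_of_le ?_ (hLyap (x t))
    simp only [Function.comp_apply, map_neg, hKL, inner_neg_left, inner_neg_right, hKsymm, hPsymm,
      inner_add_left, inner_add_right, map_add, ContinuousLinearMap.adjoint_inner_left]
    rw [← hPsymm (x t) (A (x t)), ← hPsymm (x t) ((O t).adjoint (z t)),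
      ContinuousLinearMap.adjoint_inner_right, real_inner_comm (A (x t)) (P (x t)),
      real_inner_comm (O t (P (x t))) (z t)]
    ring
  have hY : ∀ t ≥ t₀, ∃ y, HasDerivAt Y y t ∧
      y ≤ C₁ * ‖x t‖ ^ 2 + C₂ * ‖x t‖ * ‖z t‖ - a * ‖z t‖ ^ 2 := by
    intro t ht
    have h1 := ((hz t ht).inner ℝ ((hO t ht).clm_apply (hx t ht))).const_mul T
    have h2 := ((hS t).clm_apply (hz t ht)).inner ℝ (hz t ht)
    refine ⟨_, h1.neg.sub h2, ?_⟩
    have hOt := hOC t ht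
    have e1 : ‖L (O t (P (x t)))‖ ≤ ‖L‖ * C * ‖P‖ * ‖x t‖ :=
      calc _ ≤ ‖L‖ * (‖O t‖ * (‖P‖ * ‖x t‖)) :=
            L.le_opNorm_of_le ((O t).le_opNorm_of_le (P.le_opNorm _))
        _ ≤ ‖L‖ * (C * (‖P‖ * ‖x t‖)) := by gcongr
        _ = _ := by ring
    have e2 : ‖O t (x t)‖ ≤ C * ‖x t‖ := (O t).le_of_opNorm_le hOt _
    have e3 : ‖O' t (x t)‖ ≤ C * ‖x t‖ := (O' t).le_of_opNorm_le (hO'C t ht) _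
    have e4 : ‖O t (A (x t))‖ ≤ C * ‖A‖ * ‖x t‖ :=
      calc _ ≤ C * ‖A (x t)‖ := (O t).le_of_opNorm_le hOt _
        _ ≤ C * (‖A‖ * ‖x t‖) := by gcongr; exact A.le_opNorm _
        _ = _ := by ring
    have e5 : ‖S t (z t)‖ ≤ R * ‖z t‖ := (S t).le_of_opNorm_le (hSB t) _
    have e6 : ‖S t (L (O t (P (x t))))‖ ≤ R * (‖L‖ * C * ‖P‖ * ‖x t‖) :=
      calc _ ≤ R * ‖L (O t (P (x t)))‖ := (S t).le_of_opNorm_le (hSB t) _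
        _ ≤ _ := by gcongr
    have i1 : inner ℝ (L (O t (P (x t)))) (O t (x t)) ≤ ‖L‖ * C * ‖P‖ * ‖x t‖ * (C * ‖x t‖) :=
      (real_inner_le_norm _ _).trans (by gcongr)
    have i2 : -inner ℝ (z t) (O' t (x t)) ≤ ‖z t‖ * (C * ‖x t‖) :=
      (neg_le_abs _).trans ((abs_real_inner_le_norm _ _).trans (by gcongr))
    have i3 : -inner ℝ (z t) (O t (A (x t))) ≤ ‖z t‖ * (C * ‖A‖ * ‖x t‖) :=
      (neg_le_abs _).trans ((abs_real_inner_le_norm _ _).trans (by gcongr))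
    have i4 : inner ℝ (S t (z t)) (L (O t (P (x t)))) ≤ R * ‖z t‖ * (‖L‖ * C * ‖P‖ * ‖x t‖) :=
      (real_inner_le_norm _ _).trans (by gcongr)
    have i5 : inner ℝ (S t (L (O t (P (x t))))) (z t) ≤ R * (‖L‖ * C * ‖P‖ * ‖x t‖) * ‖z t‖ :=
      (real_inner_le_norm _ _).trans (by gcongr)
    have i6 := hJ t ht (z t)
    have i7 : inner ℝ (z t) (O t ((O t).adjoint (z t))) = inner ℝ (M t (z t)) (z t) := by
      rw [real_inner_comm, hMinner t ht, ← ContinuousLinearMap.adjoint_inner_right,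
        real_inner_self_eq_norm_sq]
    simp only [map_add, map_neg, inner_add_right, inner_add_left, inner_neg_right, inner_neg_left,
      _root_.sub_apply, _root_.smul_apply, inner_sub_left,
      real_inner_smul_left, i7]
    have j1 := mul_le_mul_of_nonneg_left i1 hT.le
    have j2 := mul_le_mul_of_nonneg_left i2 hT.le
    have j3 := mul_le_mul_of_nonneg_left i3 hT.le
    simp only [C₁, C₂]
    linarith
  choose! V' hV' hV'le using hV
  choose! Y' hY' hY'le using hY
  have hYB : ∀ t ≥ t₀, |Y t| ≤ D * (‖x t‖ ^ 2 + ‖z t‖ ^ 2) := by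
    intro t ht
    have h1 : |inner ℝ (z t) (O t (x t))| ≤ ‖z t‖ * (C * ‖x t‖) :=
      (abs_real_inner_le_norm _ _).trans (by
        gcongr; exact (O t).le_of_opNorm_le (hOC t ht) _)
    have h2 : |inner ℝ (S t (z t)) (z t)| ≤ R * ‖z t‖ * ‖z t‖ :=
      (abs_real_inner_le_norm _ _).trans (by
        gcongr; exact (S t).le_of_opNorm_le (hSB t) _)
    calc |Y t| ≤ T * |inner ℝ (z t) (O t (x t))| + |inner ℝ (S t (z t)) (z t)| := by
          refine (abs_sub _ _).trans (le_of_eq ?_)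
          rw [abs_neg, abs_mul, abs_of_pos hT]
      _ ≤ T * (‖z t‖ * (C * ‖x t‖)) + R * ‖z t‖ * ‖z t‖ := by gcongr
      _ ≤ D * (‖x t‖ ^ 2 + ‖z t‖ ^ 2) := by
        have : 0 ≤ T * C * ((‖x t‖ - ‖z t‖) ^ 2 + ‖x t‖ ^ 2 + ‖z t‖ ^ 2) / 2 + R * ‖x t‖ ^ 2 := by
          positivity
        simp only [D]
        linarith
  have hεY : ∀ t ≥ t₀, |ε * Y t| ≤ m / 2 * (‖x t‖ ^ 2 + ‖z t‖ ^ 2) := fun t ht => by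
    rw [abs_mul, abs_of_pos hε]
    calc _ ≤ ε * (D * (‖x t‖ ^ 2 + ‖z t‖ ^ 2)) := by gcongr; exact hYB t ht
      _ = ε * D * (‖x t‖ ^ 2 + ‖z t‖ ^ 2) := by ring
      _ ≤ _ := by gcongr
  refine sqrt_le_exp_of_quadratic_lyapunov (N := fun t => ‖x t‖ ^ 2 + ‖z t‖ ^ 2)
    (W := fun t => V t + ε * Y t) (half_pos hm) hc₂ hc₃
    (fun t ht => (hV' t ht).add ((hY' t ht).const_mul ε)) ?_ ?_ ?_ hs hst
  · intro t ht
    have h1 : m * (‖x t‖ ^ 2 + ‖z t‖ ^ 2) ≤ V t := by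
      calc _ = m * ‖x t‖ ^ 2 + m * ‖z t‖ ^ 2 := by ring
        _ ≤ mP * ‖x t‖ ^ 2 + mK * ‖z t‖ ^ 2 := by
          gcongr
          · exact min_le_left _ _
          · exact min_le_right _ _
        _ ≤ _ := add_le_add (hP _) (hK _)
    linarith [neg_abs_le (ε * Y t), hεY t ht]
  · intro t ht
    have h1 : V t ≤ ‖P‖ * ‖x t‖ * ‖x t‖ + ‖K‖ * ‖z t‖ * ‖z t‖ := by
      refine add_le_add ?_ ?_
      · exact (real_inner_le_norm _ _).trans (by gcongr; exact P.le_opNorm _)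
      · exact (real_inner_le_norm _ _).trans (by gcongr; exact K.le_opNorm _)
    have h2 := le_abs_self (ε * Y t)
    have h3 := hεY t ht
    have h4 : 0 ≤ ‖P‖ * ‖z t‖ ^ 2 + ‖K‖ * ‖x t‖ ^ 2 + m / 2 * (‖x t‖ ^ 2 + ‖z t‖ ^ 2) := by
      positivity
    simp only [c₂]
    linarith
  · intro t ht
    have hyoung : C₂ * ‖x t‖ * ‖z t‖ ≤ C₂ ^ 2 / (2 * a) * ‖x t‖ ^ 2 + a / 2 * ‖z t‖ ^ 2 := by
      have : 0 ≤ (C₂ * ‖x t‖ - a * ‖z t‖) ^ 2 / (2 * a) := by positivity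
      have e : (C₂ * ‖x t‖ - a * ‖z t‖) ^ 2 / (2 * a) = C₂ ^ 2 / (2 * a) * ‖x t‖ ^ 2 +
          a / 2 * ‖z t‖ ^ 2 - C₂ * ‖x t‖ * ‖z t‖ := by field_simp; ring
      linarith
    have h1 : ε * Y' t ≤ ε * ((C₁ + C₂ ^ 2 / (2 * a)) * ‖x t‖ ^ 2 - a / 2 * ‖z t‖ ^ 2) := by
      gcongr
      linarith [hY'le t ht]
    have h2 := mul_le_mul_of_nonneg_right hε₁ (sq_nonneg ‖x t‖)
    have h3 : c₃ * ‖x t‖ ^ 2 ≤ q / 2 * ‖x t‖ ^ 2 := by gcongr; exact min_le_left _ _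
    have h4 : c₃ * ‖z t‖ ^ 2 ≤ ε * a / 2 * ‖z t‖ ^ 2 := by gcongr; exact min_le_right _ _
    linarith [hV'le t ht]

theorem HasDerivAt.linearMap_matrix {m n : ℕ} {F : Type*} [NormedAddCommGroup F]
    [NormedSpace ℝ F] (Φ : Matrix (Fin m) (Fin n) ℝ →ₗ[ℝ] F) {W : ℝ → Matrix (Fin m) (Fin n) ℝ}
    {W' : Matrix (Fin m) (Fin n) ℝ} {t : ℝ}
    (h : ∀ i j, HasDerivAt (fun s => W s i j) (W' i j) t) :
    HasDerivAt (fun s => Φ (W s)) (Φ W') t := by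
  have key : ∀ B : Matrix (Fin m) (Fin n) ℝ,
      Φ B = ∑ i, ∑ j, B i j • Φ (Matrix.single i j (1 : ℝ)) := fun B => by
    conv_lhs => rw [Matrix.matrix_eq_sum_single B]
    simp only [← map_smul, ← map_sum, Matrix.smul_single, smul_eq_mul, mul_one]
  rw [key W', show (fun s => Φ (W s)) = _ from funext fun s => key (W s)]
  exact HasDerivAt.fun_sum fun i _ => HasDerivAt.fun_sum fun j _ => (h i j).smul_const _

theorem hasDerivAt_toEuclideanLin {m n : ℕ} {W : ℝ → Matrix (Fin m) (Fin n) ℝ}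
    {W' : Matrix (Fin m) (Fin n) ℝ} {t : ℝ}
    (h : ∀ i j, HasDerivAt (fun s => W s i j) (W' i j) t) :
    HasDerivAt (fun s => LinearMap.toContinuousLinearMap (Matrix.toEuclideanLin (W s)))
      (LinearMap.toContinuousLinearMap (Matrix.toEuclideanLin W')) t :=
  HasDerivAt.linearMap_matrix
    (LinearMap.toContinuousLinearMap.toLinearMap ∘ₗ Matrix.toEuclideanLin.toLinearMap) h

theorem integral_sum_sum_mul_const {p : ℕ} {s t : ℝ} {g : Fin p → Fin p → ℝ → ℝ}
    (hg : ∀ i j, IntervalIntegrable (g i j) MeasureTheory.volume s t) (c : Fin p → Fin p → ℝ) :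
    ∫ τ in s..t, ∑ i, ∑ j, g i j τ * c i j = ∑ i, ∑ j, (∫ τ in s..t, g i j τ) * c i j := by
  have hi : ∀ i j, IntervalIntegrable (fun τ => g i j τ * c i j) MeasureTheory.volume s t :=
    fun i j => (hg i j).mul_const _
  have hs : ∀ i, IntervalIntegrable (fun τ => ∑ j, g i j τ * c i j) MeasureTheory.volume s t :=
    fun i => by
      have h := IntervalIntegrable.sum Finset.univ fun j _ => hi i j
      rwa [show (∑ j, fun τ => g i j τ * c i j) = fun τ => ∑ j, g i j τ * c i j from
        funext fun τ => Finset.sum_apply _ _ _] at h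
  rw [intervalIntegral.integral_finsetSum fun i _ => hs i]
  refine Finset.sum_congr rfl fun i _ => ?_
  rw [intervalIntegral.integral_finsetSum fun j _ => hi i j]
  exact Finset.sum_congr rfl fun j _ => intervalIntegral.integral_mul_const _ _

theorem Matrix.PosSemidef.inner_toEuclideanLin_nonneg {p : ℕ} {M : Matrix (Fin p) (Fin p) ℝ}
    (hM : M.PosSemidef) (x : EuclideanSpace ℝ (Fin p)) :
    0 ≤ inner ℝ (Matrix.toEuclideanLin M x) x := by
  simpa [EuclideanSpace.inner_eq_star_dotProduct, Matrix.toLpLin_apply] using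
    hM.dotProduct_mulVec_nonneg (WithLp.ofLp x)

theorem adjoint_toEuclideanLin {m n : ℕ} (W : Matrix (Fin m) (Fin n) ℝ) :
    (LinearMap.toContinuousLinearMap (Matrix.toEuclideanLin W)).adjoint =
      LinearMap.toContinuousLinearMap (Matrix.toEuclideanLin Wᵀ) := by
  rw [← Matrix.conjTranspose_eq_transpose_of_trivial, Matrix.toEuclideanLin_conjTranspose_eq_adjoint]
  rfl

theorem toEuclideanLin_mul_apply {l m n : ℕ} (B : Matrix (Fin l) (Fin m) ℝ)
    (D : Matrix (Fin m) (Fin n) ℝ) (x : EuclideanSpace ℝ (Fin n)) :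
    Matrix.toEuclideanLin (B * D) x = Matrix.toEuclideanLin B (Matrix.toEuclideanLin D x) := by
  simp [Matrix.toLpLin_apply, Matrix.mulVec_mulVec]

theorem inner_toEuclideanLin_left {m n : ℕ} (W : Matrix (Fin m) (Fin n) ℝ)
    (x : EuclideanSpace ℝ (Fin n)) (y : EuclideanSpace ℝ (Fin m)) :
    inner ℝ (Matrix.toEuclideanLin W x) y = inner ℝ x (Matrix.toEuclideanLin Wᵀ y) := by
  have h := ContinuousLinearMap.adjoint_inner_right
    (LinearMap.toContinuousLinearMap (Matrix.toEuclideanLin W)) x y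
  rw [adjoint_toEuclideanLin] at h
  exact h.symm

theorem inner_toEuclideanLin_self {m : ℕ} (W : Matrix (Fin m) (Fin m) ℝ)
    (x : EuclideanSpace ℝ (Fin m)) :
    inner ℝ (Matrix.toEuclideanLin W x) x = ∑ i, ∑ j, W i j * (x i * x j) := by
  simp only [PiLp.inner_apply, Matrix.toLpLin_apply, Matrix.mulVec, dotProduct,
    RCLike.inner_apply, conj_trivial, Finset.mul_sum]
  exact Finset.sum_congr rfl fun i _ => Finset.sum_congr rfl fun j _ => by ring

theorem IsPEMat.exists_le_integral {p n : ℕ} {t₀ : ℝ} {W : ℝ → Matrix (Fin p) (Fin n) ℝ}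
    (h : IsPEMat t₀ W) (hW : ∀ i j, ContinuousOn (fun s => W s i j) (Set.Ici t₀)) :
    ∃ a > (0 : ℝ), ∃ T > (0 : ℝ), ∀ t ≥ t₀, ∀ z : EuclideanSpace ℝ (Fin p),
      a * ‖z‖ ^ 2 ≤ ∫ τ in t..(t + T), ‖Matrix.toEuclideanLin (W τ)ᵀ z‖ ^ 2 := by
  obtain ⟨a, ha, T, hT, h⟩ := h
  refine ⟨a, ha, T, hT, fun t ht z => ?_⟩
  have hcont : ∀ i j, IntervalIntegrable (fun τ => (W τ * (W τ)ᵀ) i j)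
      MeasureTheory.volume t (t + T) := fun i j => by
    refine ContinuousOn.intervalIntegrable ?_
    refine ContinuousOn.mono (s := Set.Ici t₀) ?_ fun τ hτ => ?_
    · simp only [Matrix.mul_apply, Matrix.transpose_apply]
      exact continuousOn_finsetSum _ fun k _ => (hW i k).mul (hW j k)
    · rw [Set.uIcc_of_le (by linarith)] at hτ
      exact ht.le.trans hτ.1
  have hpt : ∀ τ, ‖Matrix.toEuclideanLin (W τ)ᵀ z‖ ^ 2 =
      ∑ i, ∑ j, (W τ * (W τ)ᵀ) i j * (z i * z j) := fun τ => by
    rw [← inner_toEuclideanLin_self, toEuclideanLin_mul_apply, inner_toEuclideanLin_left,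
      real_inner_self_eq_norm_sq]
  have hint : ∫ τ in t..(t + T), ‖Matrix.toEuclideanLin (W τ)ᵀ z‖ ^ 2 =
      ∑ i, ∑ j, (∫ τ in t..(t + T), (W τ * (W τ)ᵀ) i j) * (z i * z j) := by
    simp only [hpt]
    exact integral_sum_sum_mul_const hcont fun i j => z i * z j
  have hinner := (h t ht).inner_toEuclideanLin_nonneg z
  rw [map_sub, LinearMap.sub_apply, inner_sub_left, inner_toEuclideanLin_self, map_smul,
    LinearMap.smul_apply, real_inner_smul_left] at hinner
  have h1 : Matrix.toEuclideanLin (1 : Matrix (Fin p) (Fin p) ℝ) z = z := by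
    simp
  rw [h1, real_inner_self_eq_norm_sq] at hinner
  simp only [Matrix.of_apply] at hinner
  rw [hint]
  linarith

/-- Exponential stability of the linear time-varying system
`ẋ = A x + Ωᵀ z`, `ż = −Λ Ω P x` under persistence of excitation. -/
theorem stmt0 {n p : ℕ} (t₀ : ℝ)
    (A P Q : Matrix (Fin n) (Fin n) ℝ) (Λ : Matrix (Fin p) (Fin p) ℝ)
    (hA : Hurwitz A)
    (hP : P.PosDef) (hPsymm : P.IsSymm)
    (hQ : Q.PosDef) (hQsymm : Q.IsSymm)
    (hLyap : Aᵀ * P + P * A = -Q)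
    (hΛ : Λ.PosDef) (hΛsymm : Λ.IsSymm)
    (Ω Ω' : ℝ → Matrix (Fin p) (Fin n) ℝ)
    (hΩderiv : ∀ i j, ∀ t ≥ t₀, HasDerivAt (fun s => Ω s i j) (Ω' t i j) t)
    (hΩ'cont : ∀ i j, ContinuousOn (fun s => Ω' s i j) (Set.Ici t₀))
    (hΩbdd : ∃ C, ∀ t ≥ t₀, opNorm (Ω t) ≤ C)
    (hΩ'bdd : ∃ C, ∀ t ≥ t₀, opNorm (Ω' t) ≤ C)
    (hPE : IsPEMat t₀ Ω) :
    ∃ k > (0:ℝ), ∃ lam > (0:ℝ),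
      ∀ x : ℝ → EuclideanSpace ℝ (Fin n), ∀ z : ℝ → EuclideanSpace ℝ (Fin p),
        (∀ t ≥ t₀, HasDerivAt x
            (Matrix.toEuclideanLin A (x t) + Matrix.toEuclideanLin (Ω t)ᵀ (z t)) t) →
        (∀ t ≥ t₀, HasDerivAt z
            (-(Matrix.toEuclideanLin (Λ * Ω t * P) (x t))) t) →
        ∀ s ≥ t₀, ∀ t ≥ s,
          Real.sqrt (‖x t‖ ^ 2 + ‖z t‖ ^ 2) ≤
            k * Real.exp (-lam * (t - s)) * Real.sqrt (‖x s‖ ^ 2 + ‖z s‖ ^ 2) := by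
  obtain ⟨C, hC⟩ := hΩbdd
  obtain ⟨C', hC'⟩ := hΩ'bdd
  obtain ⟨a, ha, T, hT, hexc⟩ := hPE.exists_le_integral fun i j t ht =>
    (hΩderiv i j t ht).continuousAt.continuousWithinAt
  obtain ⟨mP, hmP, hPlow⟩ := exists_pos_mul_sq_le_inner hP
  obtain ⟨mK, hmK, hKlow⟩ := exists_pos_mul_sq_le_inner hΛ.inv
  obtain ⟨q, hq, hQlow⟩ := exists_pos_mul_sq_le_inner hQ
  let c := fun {k l : ℕ} (B : Matrix (Fin k) (Fin l) ℝ) =>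
    LinearMap.toContinuousLinearMap (Matrix.toEuclideanLin B)
  have hQinner : ∀ x : EuclideanSpace ℝ (Fin n),
      2 * inner ℝ (Matrix.toEuclideanLin P x) (Matrix.toEuclideanLin A x) =
        -inner ℝ (Matrix.toEuclideanLin Q x) x := fun x => by
    have h : inner ℝ (Matrix.toEuclideanLin (Aᵀ * P + P * A) x) x =
        inner ℝ (Matrix.toEuclideanLin (-Q) x) x := by rw [hLyap]
    rw [map_add, map_neg, LinearMap.add_apply, LinearMap.neg_apply, inner_neg_left,
      inner_add_left, toEuclideanLin_mul_apply, toEuclideanLin_mul_apply,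
      inner_toEuclideanLin_left Aᵀ, inner_toEuclideanLin_left P (Matrix.toEuclideanLin A x),
      Matrix.transpose_transpose, hPsymm.eq,
      real_inner_comm (Matrix.toEuclideanLin P x) (Matrix.toEuclideanLin A x)] at h
    linarith
  obtain ⟨k, hk, lam, hlam, H⟩ := exponentially_stable_of_persistentlyExciting (t₀ := t₀)
    (c A) (c P) (c Λ) (c Λ⁻¹) (C := max C C')
    (fun x y => (inner_toEuclideanLin_left P x y).trans (by rw [hPsymm.eq]; rfl))
    (fun x y => (inner_toEuclideanLin_left Λ⁻¹ x y).trans (by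
      rw [Matrix.transpose_nonsing_inv, hΛsymm.eq]; rfl))
    (fun z => by
      have h := toEuclideanLin_mul_apply Λ⁻¹ Λ z
      rw [Matrix.nonsing_inv_mul _ ((Matrix.isUnit_iff_isUnit_det _).1 hΛ.isUnit)] at h
      refine h.symm.trans ?_
      simp)
    hmP hPlow hmK hKlow hq
    (fun x => (hQinner x).trans_le (neg_le_neg (hQlow x)))
    (fun t => c (Ω t)) (fun t => c (Ω' t))
    (fun t ht => hasDerivAt_toEuclideanLin fun i j => hΩderiv i j t ht)
    (fun t ht => (hC t ht).trans (le_max_left _ _))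
    (fun t ht => (hC' t ht).trans (le_max_right _ _)) ha hT
    (fun t ht z => by simpa only [c, adjoint_toEuclideanLin] using! hexc t ht z)
  refine ⟨k, hk, lam, hlam, fun x z hx hz => H x z (fun t ht => ?_) fun t ht => ?_⟩
  · simpa only [c, adjoint_toEuclideanLin] using! hx t ht
  · simpa only [toEuclideanLin_mul_apply] using! hz t ht
end

section
/- Under the same hypotheses as the asymptotic observer convergence theorem (block-diagonal M Hurwitz, N, Φ, Γ, invertible T with T Φ − M T = N Γ, Ψ = Γ T⁻¹; exosystem ϱ̇ = T Φ T⁻¹ ϱ with ϱ and ϱ̇ uniformly bounded; plant ẋ₂ = g(t) − Ψ ϱ; internal model η̇ = M η + N g(t) − M N x₂ with ϱ̂ := η − N x₂; observer x̂₂̇ = g(t) − M(ϱ̂) θ + K (x̂₂ − x₂), θ̇ = Λ M(ϱ̂)ᵀ P (x̂₂ − x₂), with K Hurwitz, P symmetric positive definite such that Kᵀ P + P K = −I, Λ symmetric positive definite; d := −Ψ ϱ and d̂ := −M(ϱ̂) θ), assume in addition that each block ϱ_i : [0,∞) → ℝ^{r_i} of ϱ = col(ϱ₁,…,ϱ_{n₂})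 is persistently exciting. Then, for all initial conditions, x̂₂(t) − x₂(t) → 0 exponentially, d̂(t) − d(t) → 0 exponentially, and θ(t) → C(Ψ) exponentially as t → ∞. -/
open Matrix Filter Topology

/-- `e(t) → 0` exponentially: `‖e t‖ ≤ c e^{-λ t}` for all sufficiently large `t`. -/
def ExpDecay {E : Type*} [Norm E] (e : ℝ → E) : Prop :=
  ∃ c > (0:ℝ), ∃ lam > (0:ℝ), ∃ T : ℝ, ∀ t ≥ T, ‖e t‖ ≤ c * Real.exp (-lam * t)

/-- A vector-valued function `w` on `[t₀, ∞)` is persistently exciting: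
`∫_t^{t+T₀} w(τ) w(τ)ᵀ dτ ⪰ a I` for all `t ≥ t₀`. -/
def IsPEVec {ι : Type*} [Fintype ι] [DecidableEq ι] (t₀ : ℝ) (w : ℝ → ι → ℝ) : Prop :=
  ∃ a > (0:ℝ), ∃ T₀ > (0:ℝ), ∀ t ≥ t₀,
    ((Matrix.of fun i j => ∫ τ in t..(t + T₀), w τ i * w τ j)
      - a • (1 : Matrix ι ι ℝ)).PosSemidef

/-- Block index set `Σ i, Fin (r i)` for stacked vectors `col(v₁,…,v_{n₂})`
with `v_i ∈ ℝ^{r i}`. -/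
abbrev BIdx {n₂ : ℕ} (r : Fin n₂ → ℕ) := Σ i : Fin n₂, Fin (r i)

/-- A square matrix indexed by `BIdx r` is block diagonal. -/
def IsBlkDiag {n₂ : ℕ} {r : Fin n₂ → ℕ} (A : Matrix (BIdx r) (BIdx r) ℝ) : Prop :=
  ∀ a b : BIdx r, a.1 ≠ b.1 → A a b = 0

/-- `N = blkdiag(N₁,…,N_{n₂})` with `N_i ∈ ℝ^{r_i × 1}`. -/
def IsBlkCol {n₂ : ℕ} {r : Fin n₂ → ℕ} (N : Matrix (BIdx r) (Fin n₂) ℝ) : Prop :=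
  ∀ (a : BIdx r) (j : Fin n₂), a.1 ≠ j → N a j = 0

/-- `Γ = blkdiag(Γ₁,…,Γ_{n₂})` with `Γ_i ∈ ℝ^{1 × r_i}`. -/
def IsBlkRow {n₂ : ℕ} {r : Fin n₂ → ℕ} (Γ : Matrix (Fin n₂) (BIdx r) ℝ) : Prop :=
  ∀ (j : Fin n₂) (a : BIdx r), j ≠ a.1 → Γ j a = 0

/-- `𝓜(ϱ) = blkdiag(ϱ₁ᵀ,…,ϱ_{n₂}ᵀ) ∈ ℝ^{n₂ × r̄}` built from a stacked vector. -/
def MMat {n₂ : ℕ} {r : Fin n₂ → ℕ} (v : EuclideanSpace ℝ (BIdx r)) :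
    Matrix (Fin n₂) (BIdx r) ℝ :=
  Matrix.of fun i a => if a.1 = i then v a else 0

/-- `𝓒(Ψ) = col(Ψ₁ᵀ,…,Ψ_{n₂}ᵀ) ∈ ℝ^{r̄}` built from a block-row matrix. -/
noncomputable def CVec {n₂ : ℕ} {r : Fin n₂ → ℕ} (Ψ : Matrix (Fin n₂) (BIdx r) ℝ) :
    EuclideanSpace ℝ (BIdx r) :=
  (WithLp.equiv 2 _).symm fun a => Ψ a.1 a

theorem ExpDecay.of_eventually_norm_le {E F : Type*} [SeminormedAddCommGroup E]
    [SeminormedAddCommGroup F] {f : ℝ → E} {g : ℝ → F}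
    (hg : ExpDecay g) {C : ℝ} (hfg : ∀ᶠ t in atTop, ‖f t‖ ≤ C * ‖g t‖) : ExpDecay f := by
  obtain ⟨c, hc, lam, hlam, T, hT⟩ := hg
  obtain ⟨S, hS⟩ := eventually_atTop.1 hfg
  refine ⟨(|C| + 1) * c, by positivity, lam, hlam, max T S, fun t ht => ?_⟩
  have h1 := hT t (le_trans (le_max_left _ _) ht)
  have h2 := hS t (le_trans (le_max_right _ _) ht)
  have h4 : ‖f t‖ ≤ |C| * ‖g t‖ :=
    h2.trans (mul_le_mul_of_nonneg_right (le_abs_self C) (norm_nonneg _))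
  nlinarith [mul_le_mul_of_nonneg_left h1 (abs_nonneg C),
    mul_pos hc (Real.exp_pos (-lam * t))]

theorem expDecay_of_deriv_le {w w' : ℝ → ℝ} {c C lam : ℝ} (hc : 0 < c) (hC : 0 ≤ C)
    (hlam : 0 < lam) (hw : ∀ᶠ t in atTop, HasDerivAt w (w' t) t)
    (hnn : ∀ᶠ t in atTop, 0 ≤ w t)
    (hle : ∀ᶠ t in atTop, w' t ≤ -c * w t + C * Real.exp (-lam * t) * (w t + 1)) :
    ExpDecay w := by
  have hsmall : ∀ᶠ t in atTop, C * Real.exp (-lam * t) ≤ c / 2 := by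
    have h1 : Tendsto (fun t : ℝ => -lam * t) atTop atBot :=
      tendsto_id.const_mul_atTop_of_neg (by linarith)
    have h2 : Tendsto (fun t : ℝ => C * Real.exp (-lam * t)) atTop (𝓝 (C * 0)) :=
      (Real.tendsto_exp_atBot.comp h1).const_mul C
    rw [mul_zero] at h2
    exact h2.eventually_le_const (by positivity)
  obtain ⟨t₀, ht₀⟩ := eventually_atTop.1 (hw.and (hnn.and (hle.and hsmall)))
  obtain ⟨μ, hμ, hμc, hμl⟩ : ∃ μ > 0, μ ≤ c / 2 ∧ μ < lam :=
    ⟨min (c / 2) (lam / 2), by positivity, min_le_left _ _,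
      (min_le_right _ _).trans_lt (by linarith)⟩
  let f : ℝ → ℝ := fun t => Real.exp (μ * t) * w t + C / (lam - μ) * Real.exp ((μ - lam) * t)
  have hf : ∀ t ≥ t₀, HasDerivAt f
      (Real.exp (μ * t) * (μ * w t + w' t - C * Real.exp (-lam * t))) t := by
    intro t ht
    have e1 : HasDerivAt (fun t => Real.exp (μ * t)) (Real.exp (μ * t) * μ) t := by
      simpa using ((hasDerivAt_id t).const_mul μ).exp
    have e2 : HasDerivAt (fun t => Real.exp ((μ - lam) * t))
        (Real.exp ((μ - lam) * t) * (μ - lam)) t := by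
      simpa using ((hasDerivAt_id t).const_mul (μ - lam)).exp
    have h := (e1.mul (ht₀ t ht).1).add (e2.const_mul (C / (lam - μ)))
    refine h.congr_deriv ?_
    have e3 : Real.exp ((μ - lam) * t) = Real.exp (μ * t) * Real.exp (-lam * t) := by
      rw [← Real.exp_add]; ring_nf
    have : lam - μ ≠ 0 := by linarith
    rw [e3]
    field_simp
    ring
  have hanti : AntitoneOn f (Set.Ici t₀) := by
    refine antitoneOn_of_deriv_nonpos (convex_Ici _)
      (fun t ht => (hf t ht).continuousAt.continuousWithinAt) ?_ ?_
    · intro t ht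
      rw [interior_Ici] at ht
      exact (hf t (le_of_lt ht)).differentiableAt.differentiableWithinAt
    · intro t ht
      rw [interior_Ici] at ht
      rw [(hf t (le_of_lt ht)).deriv]
      obtain ⟨-, h2, h3, h4⟩ := ht₀ t (le_of_lt ht)
      refine mul_nonpos_of_nonneg_of_nonpos (Real.exp_nonneg _) ?_
      nlinarith [mul_le_mul_of_nonneg_right h4 h2, mul_le_mul_of_nonneg_right hμc h2]
  refine ⟨|f t₀| + 1, by positivity, μ, hμ, t₀, fun t ht => ?_⟩
  have h1 : f t ≤ f t₀ := hanti Set.self_mem_Ici ht ht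
  have h2 : Real.exp (μ * t) * w t ≤ f t := by
    have : 0 ≤ C / (lam - μ) * Real.exp ((μ - lam) * t) :=
      mul_nonneg (div_nonneg hC (by linarith)) (Real.exp_nonneg _)
    simp only [f]; linarith
  rw [Real.norm_of_nonneg (ht₀ t ht).2.1, neg_mul, Real.exp_neg, ← div_eq_mul_inv,
    le_div_iff₀ (Real.exp_pos _), mul_comm]
  linarith [le_abs_self (f t₀)]

theorem expDecay_of_hasDerivAt_smul_add {E : Type*} [NormedAddCommGroup E] [NormedSpace ℂ E]
    {z w : ℝ → E} {μ : ℂ} (hμ : μ.re < 0)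
    (hz : ∀ᶠ t in atTop, HasDerivAt z (μ • z t + w t) t) (hw : ExpDecay w) : ExpDecay z := by
  obtain ⟨c, hc, lam, hlam, S, hS⟩ := hw
  obtain ⟨R, hR⟩ := eventually_atTop.1 hz
  let t₀ := max (max S R) 0
  have ht₀ : ∀ t ≥ t₀, HasDerivAt z (μ • z t + w t) t ∧ ‖w t‖ ≤ c * Real.exp (-lam * t) ∧ 0 ≤ t :=
    fun t ht => ⟨hR t (le_trans (by simp [t₀]) ht), hS t (le_trans (by simp [t₀]) ht),
      le_trans (by simp [t₀]) ht⟩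
  obtain ⟨ν, hν, hνl, hνμ⟩ : ∃ ν > 0, ν ≤ lam ∧ ν < -μ.re :=
    ⟨min lam (-μ.re / 2), lt_min hlam (by linarith), min_le_left _ _,
      (min_le_right _ _).trans_lt (by linarith)⟩
  have hb : 0 < -μ.re - ν := by linarith
  let u : ℝ → E := fun t => Complex.exp (-μ * t) • z t
  have hu : ∀ t ≥ t₀, HasDerivAt u (Complex.exp (-μ * t) • w t) t := by
    intro t ht
    have e1 : HasDerivAt (fun t : ℝ => Complex.exp (-μ * t)) (Complex.exp (-μ * t) * (-μ)) t := by
      simpa using ((hasDerivAt_id t).ofReal_comp.const_mul (-μ)).cexp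
    refine (e1.smul (ht₀ t ht).1).congr_deriv ?_
    rw [smul_add, smul_smul]
    module
  have hnorm : ∀ t : ℝ, ‖Complex.exp (-μ * t)‖ = Real.exp (-μ.re * t) := by
    intro t; simp [Complex.norm_exp]
  let B : ℝ → ℝ := fun t => ‖u t₀‖ + c / (-μ.re - ν) * Real.exp ((-μ.re - ν) * t)
  have hB : ∀ t, HasDerivAt B (c * Real.exp ((-μ.re - ν) * t)) t := by
    intro t
    have e2 : HasDerivAt (fun t => Real.exp ((-μ.re - ν) * t))
        (Real.exp ((-μ.re - ν) * t) * (-μ.re - ν)) t := by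
      simpa using ((hasDerivAt_id t).const_mul (-μ.re - ν)).exp
    refine ((e2.const_mul (c / (-μ.re - ν))).const_add _).congr_deriv ?_
    field_simp
  have hbound : ∀ t ≥ t₀, ‖u t‖ ≤ B t := by
    intro t ht
    refine image_norm_le_of_norm_deriv_right_le_deriv_boundary (a := t₀) (b := t)
      (fun s hs => (hu s hs.1).continuousAt.continuousWithinAt)
      (fun s hs => (hu s hs.1).hasDerivWithinAt) ?_ hB ?_ ⟨ht, le_rfl⟩
    · have : 0 ≤ c / (-μ.re - ν) * Real.exp ((-μ.re - ν) * t₀) := by positivity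
      simp only [B]; linarith
    · intro s hs
      rw [norm_smul, hnorm]
      have h1 := (ht₀ s hs.1).2.1
      have h2 : Real.exp (-lam * s) ≤ Real.exp (-ν * s) := by
        apply Real.exp_le_exp.2
        nlinarith [(ht₀ s hs.1).2.2]
      calc Real.exp (-μ.re * s) * ‖w s‖ ≤ Real.exp (-μ.re * s) * (c * Real.exp (-ν * s)) := by
            gcongr; exact h1.trans (by gcongr)
        _ = c * Real.exp ((-μ.re - ν) * s) := by
            rw [show (-μ.re - ν) * s = -μ.re * s + -ν * s by ring, Real.exp_add]; ring
  refine ⟨‖u t₀‖ + c / (-μ.re - ν), by positivity, ν, hν, t₀, fun t ht => ?_⟩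
  have h0 := (ht₀ t ht).2.2
  have h1 := hbound t ht
  have h2 : ‖u t‖ = Real.exp (-μ.re * t) * ‖z t‖ := by rw [norm_smul, hnorm]
  have h3 : ‖z t‖ = Real.exp (μ.re * t) * ‖u t‖ := by
    rw [h2, ← mul_assoc, ← Real.exp_add]; simp
  have h4 : B t ≤ (‖u t₀‖ + c / (-μ.re - ν)) * Real.exp ((-μ.re - ν) * t) := by
    have : 1 ≤ Real.exp ((-μ.re - ν) * t) := Real.one_le_exp (by positivity)
    simp only [B]
    nlinarith [norm_nonneg (u t₀)]
  calc ‖z t‖ = Real.exp (μ.re * t) * ‖u t‖ := h3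
    _ ≤ Real.exp (μ.re * t) * ((‖u t₀‖ + c / (-μ.re - ν)) * Real.exp ((-μ.re - ν) * t)) := by
        gcongr; exact h1.trans h4
    _ = (‖u t₀‖ + c / (-μ.re - ν)) * Real.exp (-ν * t) := by
        rw [show -ν * t = μ.re * t + (-μ.re - ν) * t by ring, Real.exp_add]; ring

theorem expDecay_of_hasDerivAt_mulVec {ι : Type*} [Fintype ι] [DecidableEq ι]
    (A : Matrix ι ι ℂ) (s : Multiset ℂ) (hs : ∀ μ ∈ s, μ.re < 0) (y : ℝ → ι → ℂ)
    (hy : ∀ᶠ t in atTop, HasDerivAt y (A *ᵥ y t) t)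
    (hp : ExpDecay fun t =>
      Polynomial.aeval A (s.map fun μ => Polynomial.X - Polynomial.C μ).prod *ᵥ y t) :
    ExpDecay y := by
  induction s using Multiset.induction generalizing y with
  | empty => simpa using hp
  | cons μ s ih =>
    have hz : ExpDecay fun t => (A - Matrix.scalar ι μ) *ᵥ y t := by
      refine ih (fun ν hν => hs ν (Multiset.mem_cons_of_mem hν)) _ ?_ ?_
      · filter_upwards [hy] with t ht
        have := ((Matrix.mulVecLin (A - Matrix.scalar ι μ)).toContinuousLinearMap.restrictScalars
          ℝ).hasFDerivAt.comp_hasDerivAt t ht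
        refine this.congr_deriv ?_
        have hc : (A - Matrix.scalar ι μ) * A = A * (A - Matrix.scalar ι μ) := by
          rw [sub_mul, mul_sub, (Matrix.scalar_commute μ (fun _ => mul_comm _ _) A).eq]
        change (A - Matrix.scalar ι μ) *ᵥ (A *ᵥ y t) = A *ᵥ ((A - Matrix.scalar ι μ) *ᵥ y t)
        rw [Matrix.mulVec_mulVec, Matrix.mulVec_mulVec, hc]
      · convert hp using 2 with t
        rw [Matrix.mulVec_mulVec, Multiset.map_cons, Multiset.prod_cons, mul_comm, map_mul]
        simp [Matrix.algebraMap_eq_diagonal, Matrix.scalar_apply]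
        rfl
    refine expDecay_of_hasDerivAt_smul_add (hs μ (Multiset.mem_cons_self _ _)) ?_ hz
    filter_upwards [hy] with t ht
    refine ht.congr_deriv ?_
    rw [Matrix.sub_mulVec]
    simp

theorem Hurwitz.expDecay {ι : Type*} [Fintype ι] [DecidableEq ι] {A : Matrix ι ι ℝ}
    (hA : Hurwitz A) {e : ℝ → EuclideanSpace ℝ ι}
    (he : ∀ᶠ t in atTop, HasDerivAt e (Matrix.toEuclideanLin A (e t)) t) : ExpDecay e := by
  let y : ℝ → ι → ℂ := fun t a => (e t a : ℂ)
  have hy : ExpDecay y := by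
    refine expDecay_of_hasDerivAt_mulVec (A.map (algebraMap ℝ ℂ))
      (A.map (algebraMap ℝ ℂ)).charpoly.roots ?_ y ?_ ?_
    · intro μ hμ
      refine hA μ ?_
      have := (Polynomial.mem_roots'.1 hμ).2
      exact Matrix.mem_spectrum_iff_isRoot_charpoly.2 this
    · filter_upwards [he] with t ht
      refine hasDerivAt_pi.2 fun a => ?_
      have h1 := ((EuclideanSpace.proj a : EuclideanSpace ℝ ι →L[ℝ] ℝ).hasFDerivAt.comp_hasDerivAt
        t ht).ofReal_comp
      refine h1.congr_deriv ?_
      simp [Matrix.mulVec, dotProduct, y]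
    · rw [← (IsAlgClosed.splits (A.map (algebraMap ℝ ℂ)).charpoly).eq_prod_roots_of_monic
        (Matrix.charpoly_monic _), Matrix.aeval_self_charpoly]
      exact ⟨1, one_pos, 1, one_pos, 0, fun t _ => by simp; positivity⟩
  refine hy.of_eventually_norm_le (C := ‖((EuclideanSpace.equiv ι ℝ).symm :
    (ι → ℝ) →L[ℝ] EuclideanSpace ℝ ι)‖) (.of_forall fun t => ?_)
  have h1 := ((EuclideanSpace.equiv ι ℝ).symm :
    (ι → ℝ) →L[ℝ] EuclideanSpace ℝ ι).le_opNorm (fun a => e t a)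
  refine le_trans (le_of_eq ?_) (h1.trans (le_of_eq ?_))
  · rfl
  · congr 1
    simp [y, Pi.norm_def]
open scoped RealInnerProductSpace in
theorem abs_real_inner_le_of_norm_le {G : Type*} [NormedAddCommGroup G] [InnerProductSpace ℝ G]
    {u v : G} {p q : ℝ} (hp : ‖u‖ ≤ p) (hq : ‖v‖ ≤ q) : |⟪u, v⟫| ≤ p * q :=
  (abs_real_inner_le_norm u v).trans (mul_le_mul hp hq (norm_nonneg _) ((norm_nonneg _).trans hp))

theorem lyapunov_rate_bound {a B κ δ X Y p₁ p₂ p₃ p₄ p₅ p₆ p₇ p₈ p₉ q : ℝ} (ha : 0 < a)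
    (hB : 1 ≤ B) (hδ : 0 ≤ δ) (hX : 0 ≤ X) (hY : 0 ≤ Y) (hκ0 : 0 ≤ κ)
    (hκ : 8 * B ^ 8 / a + B ^ 4 + a ≤ κ)
    (h₁ : p₁ ≤ B * X * δ) (h₂ : p₂ ≤ B * X * (B * Y)) (h₃ : -(δ * Y * (B * Y)) ≤ p₃)
    (h₄ : p₄ ≤ δ * (B * Y)) (h₅ : p₅ ≤ X * (B * Y)) (h₆ : p₆ ≤ X * (B * (B * (B * (B * X)))))
    (h₇ : -(Y * (B * (B * (B * (B * X))))) ≤ p₇) (h₈ : -(B * (B * (B * X)) * (B * Y)) ≤ p₈)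
    (h₉ : a * Y ^ 2 - q ≤ p₉) :
    κ * (-X ^ 2 + 2 * p₁) + (p₅ + p₆ + (p₂ - p₃ - q + p₄) - (p₉ + p₇ + p₈)) ≤
      -(a / 2) * (X ^ 2 + Y ^ 2) + (κ + 2) * B * δ * (X ^ 2 + Y ^ 2 + 1) := by
  have hB0 : 0 ≤ B := by linarith
  have hBδ : 0 ≤ B * δ := mul_nonneg hB0 hδ
  have hV : κ * (-X ^ 2 + 2 * p₁) ≤ κ * (-X ^ 2 + B * δ * (X ^ 2 + 1)) := by
    refine mul_le_mul_of_nonneg_left ?_ hκ0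
    linarith [mul_nonneg hBδ (sq_nonneg (X - 1))]
  have hB4 : B ^ 2 * (X * Y) + B * (X * Y) + 2 * B ^ 4 * (X * Y) ≤ 4 * B ^ 4 * (X * Y) := by
    have k1 : B ^ 2 ≤ B ^ 4 := pow_le_pow_right₀ hB (by norm_num)
    have k2 : B ≤ B ^ 4 := le_self_pow₀ hB (by norm_num)
    linarith [mul_le_mul_of_nonneg_right (add_le_add k1 k2) (mul_nonneg hX hY)]
  have hyoung : 4 * B ^ 4 * (X * Y) ≤ a / 2 * Y ^ 2 + 8 * B ^ 8 / a * X ^ 2 := by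
    have h1 : a / 2 * Y ^ 2 + 8 * B ^ 8 / a * X ^ 2 - 4 * B ^ 4 * (X * Y) =
        (a * Y - 4 * B ^ 4 * X) ^ 2 / (2 * a) := by
      field_simp
      ring
    have h2 : 0 ≤ (a * Y - 4 * B ^ 4 * X) ^ 2 / (2 * a) := by positivity
    linarith
  have hκX := mul_le_mul_of_nonneg_right hκ (sq_nonneg X)
  have hδY : B * δ * (Y ^ 2 + Y) ≤ B * δ * (2 * (X ^ 2 + Y ^ 2 + 1)) :=
    mul_le_mul_of_nonneg_left (by nlinarith [sq_nonneg (Y - 1), sq_nonneg X]) hBδ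
  have hδX : κ * (B * δ * (X ^ 2 + 1)) ≤ κ * (B * δ * (X ^ 2 + Y ^ 2 + 1)) :=
    mul_le_mul_of_nonneg_left (mul_le_mul_of_nonneg_left (by nlinarith [sq_nonneg Y]) hBδ) hκ0
  have haX : 0 ≤ a * X ^ 2 := by positivity
  linarith

open scoped RealInnerProductSpace in
theorem expDecay_of_adaptive_error_dynamics {E F : Type*}
    [NormedAddCommGroup E] [InnerProductSpace ℝ E] [NormedAddCommGroup F] [InnerProductSpace ℝ F]
    {P K : E →L[ℝ] E} {A Λ : F →L[ℝ] F} {x d : ℝ → E} {θ : ℝ → F}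
    {φ m m' : ℝ → F →L[ℝ] E} {ψ : ℝ → E →L[ℝ] F} {Q R : ℝ → F →L[ℝ] F}
    {a c B C lam : ℝ} (ha : 0 < a) (hc : 0 < c) (hC : 0 ≤ C) (hlam : 0 < lam)
    (hPsymm : ∀ u v, ⟪P u, v⟫ = ⟪u, P v⟫) (hAsymm : ∀ u v, ⟪A u, v⟫ = ⟪u, A v⟫)
    (hPK : ∀ u, 2 * ⟪P u, K u⟫ = -‖u‖ ^ 2) (hAΛ : ∀ v, A (Λ v) = v)
    (hPc : ∀ u, c * ‖u‖ ^ 2 ≤ ⟪P u, u⟫) (hAc : ∀ v, c * ‖v‖ ^ 2 ≤ ⟪A v, v⟫)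
    (hPB : ‖P‖ ≤ B) (hKB : ‖K‖ ≤ B) (hAB : ‖A‖ ≤ B) (hΛB : ‖Λ‖ ≤ B) (hB : 1 ≤ B)
    (hψφ : ∀ t u v, ⟪ψ t u, v⟫ = ⟪u, φ t v⟫)
    (hmB : ∀ᶠ t in atTop, ‖m t‖ ≤ B) (hm'B : ∀ᶠ t in atTop, ‖m' t‖ ≤ B)
    (hψB : ∀ᶠ t in atTop, ‖ψ t‖ ≤ B) (hQB : ∀ᶠ t in atTop, ‖Q t‖ ≤ B)
    (hφm : ∀ᶠ t in atTop, ‖φ t - m t‖ ≤ C * Real.exp (-lam * t))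
    (hd : ∀ᶠ t in atTop, ‖d t‖ ≤ C * Real.exp (-lam * t))
    (hm : ∀ᶠ t in atTop, HasDerivAt m (m' t) t)
    (hQ : ∀ᶠ t in atTop, HasDerivAt Q (R t) t)
    (hR : ∀ᶠ t in atTop, ∀ v, a * ‖v‖ ^ 2 - ‖m t v‖ ^ 2 ≤ ⟪v, R t v⟫)
    (hx : ∀ᶠ t in atTop, HasDerivAt x (K (x t) - φ t (θ t) + d t) t)
    (hθ : ∀ᶠ t in atTop, HasDerivAt θ (Λ (ψ t (P (x t)))) t) :
    ExpDecay x ∧ ExpDecay θ := by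
  obtain ⟨κ, hκ1, hκ2, hκ0⟩ : ∃ κ, 8 * B ^ 8 / a + B ^ 4 + a ≤ κ ∧ 2 * B + 1 ≤ κ * c ∧ 0 ≤ κ := by
    refine ⟨(8 * B ^ 8 / a + B ^ 4 + a) + (2 * B + 1) / c, ?_, ?_, by positivity⟩
    · have : 0 ≤ (2 * B + 1) / c := by positivity
      linarith
    · have : (2 * B + 1) / c * c = 2 * B + 1 := by field_simp
      have : 0 ≤ (8 * B ^ 8 / a + B ^ 4 + a) * c := by positivity
      nlinarith
  let S : ℝ → ℝ := fun t => ‖x t‖ ^ 2 + ‖θ t‖ ^ 2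
  let W : ℝ → ℝ := fun t => κ * (⟪P (x t), x t⟫ + ⟪A (θ t), θ t⟫) +
    (⟪x t, m t (θ t)⟫ - ⟪θ t, Q t (θ t)⟫)
  let x' : ℝ → E := fun t => K (x t) - φ t (θ t) + d t
  let θ' : ℝ → F := fun t => Λ (ψ t (P (x t)))
  let W' : ℝ → ℝ := fun t =>
    κ * ((⟪P (x t), x' t⟫ + ⟪P (x' t), x t⟫) + (⟪A (θ t), θ' t⟫ + ⟪A (θ' t), θ t⟫)) +
    ((⟪x t, m' t (θ t) + m t (θ' t)⟫ + ⟪x' t, m t (θ t)⟫) -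
      (⟪θ t, R t (θ t) + Q t (θ' t)⟫ + ⟪θ' t, Q t (θ t)⟫))
  have hW : ∀ᶠ t in atTop, HasDerivAt W (W' t) t := by
    filter_upwards [hm, hQ, hx, hθ] with t hm hQ hx hθ
    have hPx := P.hasFDerivAt.comp_hasDerivAt t hx
    have hAθ := A.hasFDerivAt.comp_hasDerivAt t hθ
    exact (((hPx.inner ℝ hx).add (hAθ.inner ℝ hθ)).const_mul κ).add
      ((hx.inner ℝ (hm.clm_apply hθ)).sub (hθ.inner ℝ (hQ.clm_apply hθ)))
  have hlower : ∀ᶠ t in atTop, S t ≤ W t := by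
    filter_upwards [hmB, hQB] with t hmB hQB
    have h1 := abs_le.1 <| abs_real_inner_le_of_norm_le (le_refl ‖x t‖)
      ((m t).le_of_opNorm_le hmB (θ t))
    have h2 := abs_le.1 <| abs_real_inner_le_of_norm_le (le_refl ‖θ t‖)
      ((Q t).le_of_opNorm_le hQB (θ t))
    have h3 := mul_le_mul_of_nonneg_left (add_le_add (hPc (x t)) (hAc (θ t))) hκ0
    have h4 : (2 * B + 1) * S t ≤ κ * c * S t :=
      mul_le_mul_of_nonneg_right hκ2 (by positivity)
    have h5 : ‖x t‖ * ‖θ t‖ ≤ S t := by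
      simp only [S]; nlinarith [sq_nonneg (‖x t‖ - ‖θ t‖), sq_nonneg ‖x t‖, sq_nonneg ‖θ t‖]
    have h6 : ‖θ t‖ ^ 2 ≤ S t := by simp only [S]; nlinarith [sq_nonneg ‖x t‖]
    have h7 := mul_le_mul_of_nonneg_left (add_le_add h5 h6) (by linarith : 0 ≤ B)
    simp only [W, S] at *
    linarith
  have hupper : ∀ᶠ t in atTop, W t ≤ (κ + 2) * B * S t := by
    filter_upwards [hmB, hQB] with t hmB hQB
    have h1 := abs_le.1 <| abs_real_inner_le_of_norm_le (le_refl ‖x t‖)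
      ((m t).le_of_opNorm_le hmB (θ t))
    have h2 := abs_le.1 <| abs_real_inner_le_of_norm_le (le_refl ‖θ t‖)
      ((Q t).le_of_opNorm_le hQB (θ t))
    have h3 := abs_le.1 <| abs_real_inner_le_of_norm_le (P.le_of_opNorm_le hPB (x t))
      (le_refl ‖x t‖)
    have h4 := abs_le.1 <| abs_real_inner_le_of_norm_le (A.le_of_opNorm_le hAB (θ t))
      (le_refl ‖θ t‖)
    have h5 : ‖x t‖ * ‖θ t‖ ≤ S t := by
      simp only [S]; nlinarith [sq_nonneg (‖x t‖ - ‖θ t‖), sq_nonneg ‖x t‖, sq_nonneg ‖θ t‖]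
    have h6 : ‖θ t‖ ^ 2 ≤ S t := by simp only [S]; nlinarith [sq_nonneg ‖x t‖]
    have h7 := mul_le_mul_of_nonneg_left (add_le_add h5 h6) (by linarith : 0 ≤ B)
    have h8 := mul_le_mul_of_nonneg_left (add_le_add h3.2 h4.2) hκ0
    simp only [W, S] at *
    linarith
  have hderiv : ∀ᶠ t in atTop, W' t ≤ -(a / 2) * S t +
      (κ + 2) * B * (C * Real.exp (-lam * t)) * (S t + 1) := by
    filter_upwards [hmB, hm'B, hψB, hQB, hφm, hd, hR] with t hmB hm'B hψB hQB hφm hd hR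
    set δ := C * Real.exp (-lam * t)
    have hδ : 0 ≤ δ := by positivity
    have hB0 : 0 ≤ B := by linarith
    set X := ‖x t‖ with hX
    set Y := ‖θ t‖ with hY
    have hX0 : 0 ≤ X := norm_nonneg _
    have hY0 : 0 ≤ Y := norm_nonneg _
    have bP : ‖P (x t)‖ ≤ B * X := P.le_of_opNorm_le hPB _
    have bK : ‖K (x t)‖ ≤ B * X := K.le_of_opNorm_le hKB _
    have bm : ‖m t (θ t)‖ ≤ B * Y := (m t).le_of_opNorm_le hmB _
    have bm' : ‖m' t (θ t)‖ ≤ B * Y := (m' t).le_of_opNorm_le hm'B _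
    have bQ : ‖Q t (θ t)‖ ≤ B * Y := (Q t).le_of_opNorm_le hQB _
    have bφm : ‖(φ t - m t) (θ t)‖ ≤ δ * Y := (φ t - m t).le_of_opNorm_le hφm _
    have bθ' : ‖θ' t‖ ≤ B * (B * (B * X)) :=
      Λ.le_of_opNorm_le_of_le hΛB ((ψ t).le_of_opNorm_le_of_le hψB bP)
    have bmθ' : ‖m t (θ' t)‖ ≤ B * (B * (B * (B * X))) := (m t).le_of_opNorm_le_of_le hmB bθ'
    have bQθ' : ‖Q t (θ' t)‖ ≤ B * (B * (B * (B * X))) := (Q t).le_of_opNorm_le_of_le hQB bθ'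
    have i1 := (abs_le.1 <| abs_real_inner_le_of_norm_le bP hd).2
    have i2 := (abs_le.1 <| abs_real_inner_le_of_norm_le bK bm).2
    have i3 := (abs_le.1 <| abs_real_inner_le_of_norm_le bφm bm).1
    have i4 := (abs_le.1 <| abs_real_inner_le_of_norm_le hd bm).2
    have i5 := (abs_le.1 <| abs_real_inner_le_of_norm_le (le_refl ‖x t‖) bm').2
    have i6 := (abs_le.1 <| abs_real_inner_le_of_norm_le (le_refl ‖x t‖) bmθ').2
    have i7 := (abs_le.1 <| abs_real_inner_le_of_norm_le (le_refl ‖θ t‖) bQθ').1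
    have i8 := (abs_le.1 <| abs_real_inner_le_of_norm_le bθ' bQ).1
    have i9 := hR (θ t)
    rw [← hX] at i5 i6
    rw [← hY] at i7 i9
    have j1 : ⟪P (x t), x' t⟫ + ⟪P (x' t), x t⟫ =
        -X ^ 2 - 2 * ⟪P (x t), φ t (θ t)⟫ + 2 * ⟪P (x t), d t⟫ := by
      rw [hPsymm (x' t), real_inner_comm (P (x t)) (x' t)]
      simp only [x', inner_add_right, inner_sub_right]
      linarith [hPK (x t)]
    have j2 : ⟪A (θ t), θ' t⟫ + ⟪A (θ' t), θ t⟫ = 2 * ⟪P (x t), φ t (θ t)⟫ := by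
      rw [hAsymm (θ t), real_inner_comm (A (θ' t)) (θ t)]
      simp only [θ', hAΛ, hψφ]
      ring
    have j3 : ⟪x' t, m t (θ t)⟫ = ⟪K (x t), m t (θ t)⟫ - ⟪(φ t - m t) (θ t), m t (θ t)⟫
        - ‖m t (θ t)‖ ^ 2 + ⟪d t, m t (θ t)⟫ := by
      simp only [x', inner_add_left, inner_sub_left, _root_.sub_apply,
        real_inner_self_eq_norm_sq]
      ring
    have key := lyapunov_rate_bound ha hB hδ hX0 hY0 hκ0 hκ1 i1 i2 i3 i4 i5 i6 i7 i8 i9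
    simp only [W', S, inner_add_right (𝕜 := ℝ)]
    rw [j1, j2, j3]
    linarith
  have hWdecay : ExpDecay W := by
    have hk : 0 < (κ + 2) * B := by positivity
    refine expDecay_of_deriv_le (c := a / 2 / ((κ + 2) * B)) (C := (κ + 2) * B * C)
      (by positivity) (by positivity) hlam hW ?_ ?_
    · filter_upwards [hlower] with t h
      exact le_trans (by positivity) h
    · filter_upwards [hlower, hupper, hderiv] with t h1 h2 h3
      have h4 : a / 2 / ((κ + 2) * B) * W t ≤ a / 2 * S t := by
        calc a / 2 / ((κ + 2) * B) * W t ≤ a / 2 / ((κ + 2) * B) * ((κ + 2) * B * S t) := by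
              gcongr
          _ = a / 2 * S t := by field_simp
      have h5 : (κ + 2) * B * (C * Real.exp (-lam * t)) * (S t + 1) ≤
          (κ + 2) * B * (C * Real.exp (-lam * t)) * (W t + 1) := by gcongr
      linarith
  have hsqrt : ∀ {f : ℝ → ℝ}, (∀ᶠ t in atTop, f t ^ 2 ≤ W t) → (∀ t, 0 ≤ f t) → ExpDecay f := by
    intro f hf hf0
    obtain ⟨c, hc, μ, hμ, T, hT⟩ := hWdecay
    obtain ⟨T', hT'⟩ := eventually_atTop.1 hf
    refine ⟨√c, Real.sqrt_pos.2 hc, μ / 2, by positivity, max T T', fun t ht => ?_⟩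
    rw [Real.norm_of_nonneg (hf0 t)]
    refine abs_le_of_sq_le_sq' ?_ (by positivity) |>.2
    rw [mul_pow, Real.sq_sqrt hc.le, ← Real.exp_nat_mul]
    refine (hT' t (le_trans (le_max_right _ _) ht)).trans ((le_abs_self _).trans
      ((hT t (le_trans (le_max_left _ _) ht)).trans (le_of_eq ?_)))
    congr 2
    push_cast
    ring
  have hxd : ExpDecay fun t => ‖x t‖ := hsqrt
    (hlower.mono fun t h => le_trans (le_add_of_nonneg_right (sq_nonneg _)) h)
    fun t => norm_nonneg _
  have hθd : ExpDecay fun t => ‖θ t‖ := hsqrt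
    (hlower.mono fun t h => le_trans (le_add_of_nonneg_left (sq_nonneg _)) h)
    fun t => norm_nonneg _
  exact ⟨hxd.of_eventually_norm_le (C := 1) (.of_forall fun t => by simp),
    hθd.of_eventually_norm_le (C := 1) (.of_forall fun t => by simp)⟩
theorem exists_hasDerivAt_window_average_sub {f : ℝ → ℝ} {B T : ℝ}
    (hf : ContinuousOn f (Set.Ici 0)) (hB : ∀ t ≥ 0, |f t| ≤ B) (hT : 0 < T) :
    ∃ q : ℝ → ℝ, ∀ t > 0,
      HasDerivAt q (T⁻¹ * (∫ τ in t..(t + T), f τ) - f t) t ∧ |q t| ≤ B * T := by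
  let g : ℝ → ℝ := fun t => f (max t 0)
  have hg : Continuous g := hf.comp_continuous (by fun_prop) fun t =>
    Set.mem_Ici.2 (le_max_right t 0)
  have hgf : ∀ t ≥ 0, g t = f t := fun t ht => by simp [g, max_eq_left ht]
  have hgB : ∀ t, ‖g t‖ ≤ B := fun t => hB _ (le_max_right _ _)
  have hB0 : 0 ≤ B := (norm_nonneg _).trans (hgB 0)
  let F : ℝ → ℝ := fun t => ∫ τ in (0 : ℝ)..t, g τ
  have hF : ∀ t, HasDerivAt F (g t) t := fun t => hg.integral_hasStrictDerivAt 0 t |>.hasDerivAt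
  have hFc : Continuous F := continuous_iff_continuousAt.2 fun t => (hF t).continuousAt
  let H : ℝ → ℝ := fun t => ∫ τ in (0 : ℝ)..t, F τ
  have hH : ∀ t, HasDerivAt H (F t) t := fun t => hFc.integral_hasStrictDerivAt 0 t |>.hasDerivAt
  have hFsub : ∀ s t, F t - F s = ∫ τ in s..t, g τ := fun s t =>
    intervalIntegral.integral_interval_sub_left (hg.intervalIntegrable _ _)
      (hg.intervalIntegrable _ _)
  refine ⟨fun t => T⁻¹ * (H (t + T) - H t) - F t, fun t ht => ⟨?_, ?_⟩⟩
  · refine (((((hH (t + T)).comp_add_const t T).sub (hH t)).const_mul T⁻¹).sub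
      (hF t)).congr_deriv ?_
    rw [hgf t ht.le, hFsub]
    congr 2
    refine intervalIntegral.integral_congr fun τ hτ => hgf τ ?_
    rw [Set.uIcc_of_le (by linarith)] at hτ
    linarith [hτ.1]
  · have h1 : T⁻¹ * (H (t + T) - H t) - F t = T⁻¹ * ∫ τ in t..(t + T), (F τ - F t) := by
      rw [intervalIntegral.integral_sub (hFc.intervalIntegrable _ _) (by simp),
        intervalIntegral.integral_interval_sub_left (hFc.intervalIntegrable _ _)
          (hFc.intervalIntegrable _ _)]
      simp only [intervalIntegral.integral_const, smul_eq_mul]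
      field_simp
      ring
    have h2 : ‖∫ τ in t..(t + T), (F τ - F t)‖ ≤ B * T * |t + T - t| := by
      refine intervalIntegral.norm_integral_le_of_norm_le_const fun τ hτ => ?_
      rw [Set.uIoc_of_le (by linarith)] at hτ
      rw [hFsub]
      refine (intervalIntegral.norm_integral_le_of_norm_le_const fun s _ => hgB s).trans ?_
      rw [abs_of_pos (by linarith [hτ.1])]
      exact mul_le_mul_of_nonneg_left (by linarith [hτ.2]) hB0
    change |T⁻¹ * (H (t + T) - H t) - F t| ≤ B * T
    rw [h1, abs_mul, abs_of_pos (inv_pos.2 hT)]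
    rw [add_sub_cancel_left, abs_of_pos hT, Real.norm_eq_abs] at h2
    calc T⁻¹ * |∫ τ in t..(t + T), (F τ - F t)| ≤ T⁻¹ * (B * T * T) := by gcongr
      _ = B * T := by field_simp

theorem exists_pos_forall_le {ι : Type*} [Finite ι] {f : ι → ℝ} (hf : ∀ i, 0 < f i) :
    ∃ a > 0, ∀ i, a ≤ f i := by
  cases isEmpty_or_nonempty ι
  · exact ⟨1, one_pos, fun i => isEmptyElim i⟩
  · obtain ⟨i, hi⟩ := Finite.exists_min f
    exact ⟨f i, hf i, hi⟩

theorem norm_sq_toEuclideanLin_MMat {n₂ : ℕ} {r : Fin n₂ → ℕ} (u v : EuclideanSpace ℝ (BIdx r)) :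
    ‖Matrix.toEuclideanLin (MMat u) v‖ ^ 2 = ∑ i, (∑ k, u ⟨i, k⟩ * v ⟨i, k⟩) ^ 2 := by
  rw [EuclideanSpace.real_norm_sq_eq]
  refine Finset.sum_congr rfl fun i _ => ?_
  congr 1
  rw [Matrix.ofLp_toLpLin, Matrix.toLin'_apply]
  simp only [Matrix.mulVec, dotProduct, MMat, Matrix.of_apply, Fintype.sum_sigma]
  rw [Finset.sum_eq_single i (by
    intro j _ hj
    simp [hj]) (by simp)]
  simp

open scoped RealInnerProductSpace in
theorem exists_strictification_of_isPEVec {n₂ : ℕ} {r : Fin n₂ → ℕ}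
    {ϱ : ℝ → EuclideanSpace ℝ (BIdx r)} {C : ℝ} (hϱ : ContinuousOn ϱ (Set.Ici 0))
    (hC : ∀ t ≥ 0, ‖ϱ t‖ ≤ C) (hPE : ∀ i : Fin n₂, IsPEVec 0 (fun t a => ϱ t ⟨i, a⟩)) :
    ∃ a > 0, ∃ B, ∃ Q R : ℝ → EuclideanSpace ℝ (BIdx r) →L[ℝ] EuclideanSpace ℝ (BIdx r),
      ∀ t > 0, HasDerivAt Q (R t) t ∧ ‖Q t‖ ≤ B ∧
        ∀ v, a * ‖v‖ ^ 2 - ‖Matrix.toEuclideanLin (MMat (ϱ t)) v‖ ^ 2 ≤ ⟪v, R t v⟫ := by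
  choose α hα T hT hpe using hPE
  have hcoord : ∀ a, ContinuousOn (fun t => ϱ t a) (Set.Ici 0) := fun a =>
    (EuclideanSpace.proj a : EuclideanSpace ℝ (BIdx r) →L[ℝ] ℝ).continuous.comp_continuousOn hϱ
  have hcoordC : ∀ a, ∀ t ≥ 0, |ϱ t a| ≤ C := fun a t ht =>
    (PiLp.norm_apply_le (ϱ t) a).trans (hC t ht)
  choose q hq using fun (i : Fin n₂) (k l : Fin (r i)) =>
    exists_hasDerivAt_window_average_sub (B := C * C) ((hcoord ⟨i, k⟩).mul (hcoord ⟨i, l⟩))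
      (fun t ht => by
        simp only [Pi.mul_apply, abs_mul]
        exact mul_le_mul (hcoordC _ t ht) (hcoordC _ t ht) (abs_nonneg _)
          ((abs_nonneg _).trans (hcoordC ⟨i, k⟩ t ht))) (hT i)
  obtain ⟨a, ha, hai⟩ := exists_pos_forall_le fun i => div_pos (hα i) (hT i)
  let E : ∀ i : Fin n₂, Fin (r i) → Fin (r i) →
      EuclideanSpace ℝ (BIdx r) →L[ℝ] EuclideanSpace ℝ (BIdx r) := fun i k l =>
    (EuclideanSpace.proj ⟨i, k⟩ : EuclideanSpace ℝ (BIdx r) →L[ℝ] ℝ).smulRight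
      (EuclideanSpace.single ⟨i, l⟩ (1 : ℝ))
  let p : ℝ → ∀ i : Fin n₂, Fin (r i) → Fin (r i) → ℝ := fun t i k l =>
    (T i)⁻¹ * (∫ τ in t..(t + T i), ϱ τ ⟨i, k⟩ * ϱ τ ⟨i, l⟩) - ϱ t ⟨i, k⟩ * ϱ t ⟨i, l⟩
  refine ⟨a, ha, ∑ i, ∑ k, ∑ l, C * C * T i * ‖E i k l‖,
    fun t => ∑ i, ∑ k, ∑ l, q i k l t • E i k l, fun t => ∑ i, ∑ k, ∑ l, p t i k l • E i k l,
    fun t ht => ⟨?_, ?_, fun v => ?_⟩⟩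
  · exact HasDerivAt.fun_sum fun i _ => HasDerivAt.fun_sum fun k _ => HasDerivAt.fun_sum fun l _ =>
      (hq i k l t ht).1.smul_const (E i k l)
  · refine norm_sum_le_of_le _ fun i _ => norm_sum_le_of_le _ fun k _ =>
      norm_sum_le_of_le _ fun l _ => ?_
    rw [norm_smul]
    exact mul_le_mul_of_nonneg_right (hq i k l t ht).2 (norm_nonneg _)
  · have hE : ∀ i k l, ⟪v, E i k l v⟫ = v ⟨i, k⟩ * v ⟨i, l⟩ := by
      intro i k l
      simp [E, inner_smul_right, EuclideanSpace.inner_single_right]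
    simp only [FunLike.coe_sum, Finset.sum_apply, _root_.smul_apply,
      inner_sum, inner_smul_right, hE]
    rw [norm_sq_toEuclideanLin_MMat, EuclideanSpace.real_norm_sq_eq, Fintype.sum_sigma,
      Finset.mul_sum, ← Finset.sum_sub_distrib]
    refine Finset.sum_le_sum fun i _ => ?_
    have h1 := (hpe i t ht.le).dotProduct_mulVec_nonneg fun k => v ⟨i, k⟩
    have h2 : α i * ∑ k, v ⟨i, k⟩ ^ 2 ≤
        ∑ k, ∑ l, (∫ τ in t..(t + T i), ϱ τ ⟨i, k⟩ * ϱ τ ⟨i, l⟩) * (v ⟨i, k⟩ * v ⟨i, l⟩) := by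
      rw [Matrix.sub_mulVec, dotProduct_sub, Matrix.smul_mulVec, Matrix.one_mulVec] at h1
      simp only [dotProduct, Matrix.mulVec, Matrix.of_apply, Pi.star_apply, star_trivial,
        Pi.smul_apply, smul_eq_mul, Finset.mul_sum, sub_nonneg] at h1
      rw [Finset.mul_sum]
      refine (le_of_eq ?_).trans (h1.trans (le_of_eq ?_))
      · exact Finset.sum_congr rfl fun k _ => by ring
      · exact Finset.sum_congr rfl fun k _ => Finset.sum_congr rfl fun l _ => by ring
    have h3 : ∑ k, ∑ l, p t i k l * (v ⟨i, k⟩ * v ⟨i, l⟩) =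
        (T i)⁻¹ * (∑ k, ∑ l, (∫ τ in t..(t + T i), ϱ τ ⟨i, k⟩ * ϱ τ ⟨i, l⟩) *
          (v ⟨i, k⟩ * v ⟨i, l⟩)) - (∑ k, ϱ t ⟨i, k⟩ * v ⟨i, k⟩) ^ 2 := by
      rw [sq, Finset.sum_mul_sum, Finset.mul_sum, ← Finset.sum_sub_distrib]
      refine Finset.sum_congr rfl fun k _ => ?_
      rw [Finset.mul_sum, ← Finset.sum_sub_distrib]
      refine Finset.sum_congr rfl fun l _ => ?_
      simp only [p]
      ring
    rw [h3]
    have h4 : a * ∑ k, v ⟨i, k⟩ ^ 2 ≤ (T i)⁻¹ * (α i * ∑ k, v ⟨i, k⟩ ^ 2) := by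
      rw [← mul_assoc, inv_mul_eq_div]
      exact mul_le_mul_of_nonneg_right (hai i) (Finset.sum_nonneg fun _ _ => sq_nonneg _)
    linarith [mul_le_mul_of_nonneg_left h2 (inv_nonneg.2 (hT i).le)]

open scoped RealInnerProductSpace in
theorem inner_toEuclideanLin_transpose {m n : Type*} [Fintype m] [Fintype n] [DecidableEq m]
    [DecidableEq n] (A : Matrix m n ℝ) (u : EuclideanSpace ℝ m) (v : EuclideanSpace ℝ n) :
    ⟪Matrix.toEuclideanLin Aᵀ u, v⟫ = ⟪u, Matrix.toEuclideanLin A v⟫ := by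
  rw [← Matrix.conjTranspose_eq_transpose_of_trivial, Matrix.toEuclideanLin_conjTranspose_eq_adjoint,
    LinearMap.adjoint_inner_left]

open scoped RealInnerProductSpace in
theorem Matrix.PosDef.exists_mul_norm_sq_le_inner {n : Type*} [Fintype n] [DecidableEq n]
    {A : Matrix n n ℝ} (hA : A.PosDef) :
    ∃ c > 0, ∀ v : EuclideanSpace ℝ n, c * ‖v‖ ^ 2 ≤ ⟪Matrix.toEuclideanLin A v, v⟫ := by
  have hcont : Continuous fun v : EuclideanSpace ℝ n => ⟪Matrix.toEuclideanLin A v, v⟫ :=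
    (LinearMap.continuous_of_finiteDimensional _).inner continuous_id
  have hpos : ∀ v : EuclideanSpace ℝ n, v ≠ 0 → 0 < ⟪Matrix.toEuclideanLin A v, v⟫ := by
    intro v hv
    have := hA.dotProduct_mulVec_pos (x := v.ofLp) (by simpa using hv)
    rw [EuclideanSpace.inner_eq_star_dotProduct, Matrix.ofLp_toLpLin, Matrix.toLin'_apply]
    rw [dotProduct_comm] at this ⊢
    simpa [dotProduct_comm] using this
  obtain ⟨c, hc, hcv⟩ := (isCompact_sphere (0 : EuclideanSpace ℝ n) 1).exists_forall_le'
    hcont.continuousOn (a := 0) fun v hv => hpos v (by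
      rintro rfl
      simp at hv)
  refine ⟨c, hc, fun v => ?_⟩
  rcases eq_or_ne v 0 with rfl | hv
  · simp
  have hn : ‖v‖ ≠ 0 := norm_ne_zero_iff.2 hv
  have h1 := hcv (‖v‖⁻¹ • v) (by simp [norm_smul, hn])
  simp only [map_smul, inner_smul_left, inner_smul_right, conj_trivial] at h1
  calc c * ‖v‖ ^ 2 ≤ ‖v‖⁻¹ * (‖v‖⁻¹ * ⟪Matrix.toEuclideanLin A v, v⟫) * ‖v‖ ^ 2 := by gcongr
    _ = ⟪Matrix.toEuclideanLin A v, v⟫ := by field_simp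

theorem isBlkDiag_iff_commute {n₂ : ℕ} {r : Fin n₂ → ℕ} {A : Matrix (BIdx r) (BIdx r) ℝ} :
    IsBlkDiag A ↔ Commute A (Matrix.diagonal fun a => ((a.1 : ℕ) : ℝ)) := by
  rw [commute_iff_eq, ← Matrix.ext_iff]
  simp only [Matrix.mul_diagonal, Matrix.diagonal_mul]
  constructor
  · intro h a b
    by_cases hab : a.1 = b.1
    · rw [hab, mul_comm]
    · simp [h a b hab]
  · intro h a b hab
    have h1 : ((b.1 : ℕ) : ℝ) - ((a.1 : ℕ) : ℝ) ≠ 0 := by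
      rw [sub_ne_zero, Ne, Nat.cast_inj]
      exact fun h => hab (Fin.ext h.symm)
    have h2 : A a b * (((b.1 : ℕ) : ℝ) - ((a.1 : ℕ) : ℝ)) = 0 := by linarith [h a b]
    exact (mul_eq_zero.1 h2).resolve_right h1

theorem IsBlkDiag.inv {n₂ : ℕ} {r : Fin n₂ → ℕ} {A : Matrix (BIdx r) (BIdx r) ℝ}
    (hA : IsBlkDiag A) (hu : IsUnit A) : IsBlkDiag A⁻¹ := by
  obtain ⟨u, rfl⟩ := hu
  rw [isBlkDiag_iff_commute] at hA ⊢
  rw [← Matrix.coe_units_inv]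
  exact Commute.units_inv_left hA

theorem IsBlkRow.mul {n₂ : ℕ} {r : Fin n₂ → ℕ} {Γ : Matrix (Fin n₂) (BIdx r) ℝ}
    {A : Matrix (BIdx r) (BIdx r) ℝ} (hΓ : IsBlkRow Γ) (hA : IsBlkDiag A) :
    IsBlkRow (Γ * A) := by
  intro j a hja
  rw [Matrix.mul_apply]
  refine Finset.sum_eq_zero fun b _ => ?_
  by_cases hb : j = b.1
  · rw [hA b a (hb ▸ hja), mul_zero]
  · rw [hΓ j b hb, zero_mul]

theorem IsBlkRow.toEuclideanLin_eq {n₂ : ℕ} {r : Fin n₂ → ℕ} {Ψ : Matrix (Fin n₂) (BIdx r) ℝ}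
    (hΨ : IsBlkRow Ψ) (v : EuclideanSpace ℝ (BIdx r)) :
    Matrix.toEuclideanLin Ψ v = Matrix.toEuclideanLin (MMat v) (CVec Ψ) := by
  ext i
  simp only [Matrix.ofLp_toLpLin, Matrix.toLin'_apply, Matrix.mulVec, dotProduct]
  refine Finset.sum_congr rfl fun a _ => ?_
  by_cases h : a.1 = i
  · subst h
    simp [MMat, CVec, mul_comm]
  · rw [hΨ i a (Ne.symm h)]
    simp [MMat, h]

/-- The linear map `v ↦ MMat v`, with values in continuous linear maps. -/
noncomputable def MMatCLM {n₂ : ℕ} (r : Fin n₂ → ℕ) : EuclideanSpace ℝ (BIdx r) →L[ℝ]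
    EuclideanSpace ℝ (BIdx r) →L[ℝ] EuclideanSpace ℝ (Fin n₂) :=
  LinearMap.toContinuousLinearMap
    { toFun := fun v => LinearMap.toContinuousLinearMap (Matrix.toEuclideanLin (MMat v))
      map_add' := fun u v => by
        have : MMat (u + v) = MMat u + MMat v := by
          ext i a
          by_cases h : a.1 = i <;> simp [MMat, h]
        rw [this, map_add, map_add]
      map_smul' := fun s v => by
        have : MMat (s • v) = s • MMat v := by
          ext i a
          by_cases h : a.1 = i <;> simp [MMat, h]
        rw [this, map_smul, map_smul]
        rfl }

theorem MMatCLM_apply {n₂ : ℕ} {r : Fin n₂ → ℕ} (u v : EuclideanSpace ℝ (BIdx r)) :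
    MMatCLM r u v = Matrix.toEuclideanLin (MMat u) v := rfl

theorem ExpDecay.add {E : Type*} [SeminormedAddCommGroup E] {f g : ℝ → E}
    (hf : ExpDecay f) (hg : ExpDecay g) : ExpDecay fun t => f t + g t := by
  obtain ⟨c, hc, μ, hμ, S, hS⟩ := hf
  obtain ⟨d, hd, ν, hν, T, hT⟩ := hg
  refine ⟨c + d, by positivity, min μ ν, lt_min hμ hν, max (max S T) 0, fun t ht => ?_⟩
  simp only [ge_iff_le, max_le_iff] at ht
  have h1 : Real.exp (-μ * t) ≤ Real.exp (-min μ ν * t) :=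
    Real.exp_le_exp.2 (by nlinarith [min_le_left μ ν, ht.2])
  have h2 : Real.exp (-ν * t) ≤ Real.exp (-min μ ν * t) :=
    Real.exp_le_exp.2 (by nlinarith [min_le_right μ ν, ht.2])
  nlinarith [norm_add_le (f t) (g t), hS t ht.1.1, hT t ht.1.2]

theorem ExpDecay.tendsto_zero {E : Type*} [SeminormedAddCommGroup E] {f : ℝ → E}
    (hf : ExpDecay f) : Tendsto f atTop (𝓝 0) := by
  obtain ⟨c, hc, μ, hμ, S, hS⟩ := hf
  have h1 : Tendsto (fun t : ℝ => -μ * t) atTop atBot :=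
    tendsto_id.const_mul_atTop_of_neg (by linarith)
  have h2 : Tendsto (fun t : ℝ => c * Real.exp (-μ * t)) atTop (𝓝 (c * 0)) :=
    (Real.tendsto_exp_atBot.comp h1).const_mul c
  rw [mul_zero] at h2
  exact squeeze_zero_norm' (eventually_atTop.2 ⟨S, hS⟩) h2

theorem toEuclideanLin_mul {l m n : Type*} [Fintype l] [Fintype m] [Fintype n] [DecidableEq l]
    [DecidableEq m] [DecidableEq n] (A : Matrix l m ℝ) (B : Matrix m n ℝ)
    (v : EuclideanSpace ℝ n) :
    Matrix.toEuclideanLin (A * B) v = Matrix.toEuclideanLin A (Matrix.toEuclideanLin B v) := by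
  ext i
  simp [Matrix.mulVec_mulVec]

/-- Under persistence of excitation of each block `ϱ_i`, the
adaptive disturbance observer converges exponentially: `x̂₂ − x₂ → 0`,
`d̂ − d → 0`, and `θ → 𝓒(Ψ)` exponentially. -/
theorem stmt4 {n₂ : ℕ} (r : Fin n₂ → ℕ) (hr : ∀ i, 0 < r i)
    (M Φ T : Matrix (BIdx r) (BIdx r) ℝ)
    (N : Matrix (BIdx r) (Fin n₂) ℝ) (Γ : Matrix (Fin n₂) (BIdx r) ℝ)
    (hMblk : IsBlkDiag M) (hΦblk : IsBlkDiag Φ) (hTblk : IsBlkDiag T)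
    (hNblk : IsBlkCol N) (hΓblk : IsBlkRow Γ)
    (hM : Hurwitz M) (hT : IsUnit T) (hSyl : T * Φ - M * T = N * Γ)
    (K P : Matrix (Fin n₂) (Fin n₂) ℝ) (Λ : Matrix (BIdx r) (BIdx r) ℝ)
    (hK : Hurwitz K) (hP : P.PosDef) (hPsymm : P.IsSymm)
    (hKP : Kᵀ * P + P * K = -1)
    (hΛ : Λ.PosDef) (hΛsymm : Λ.IsSymm)
    (g : ℝ → EuclideanSpace ℝ (Fin n₂)) (hg : ContinuousOn g (Set.Ici 0))
    (ϱ η θ : ℝ → EuclideanSpace ℝ (BIdx r))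
    (x₂ xhat₂ : ℝ → EuclideanSpace ℝ (Fin n₂))
    (hϱ : ∀ t ≥ (0:ℝ), HasDerivAt ϱ (Matrix.toEuclideanLin (T * Φ * T⁻¹) (ϱ t)) t)
    (hϱbdd : ∃ C, ∀ t ≥ (0:ℝ), ‖ϱ t‖ ≤ C ∧
      ‖Matrix.toEuclideanLin (T * Φ * T⁻¹) (ϱ t)‖ ≤ C)
    (hPE : ∀ i : Fin n₂, IsPEVec 0 (fun t a => ϱ t ⟨i, a⟩))
    (hx₂ : ∀ t ≥ (0:ℝ), HasDerivAt x₂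
      (g t - Matrix.toEuclideanLin (Γ * T⁻¹) (ϱ t)) t)
    (hη : ∀ t ≥ (0:ℝ), HasDerivAt η
      (Matrix.toEuclideanLin M (η t) + Matrix.toEuclideanLin N (g t)
        - Matrix.toEuclideanLin (M * N) (x₂ t)) t)
    (hxhat₂ : ∀ t ≥ (0:ℝ), HasDerivAt xhat₂
      (g t - Matrix.toEuclideanLin (MMat (η t - Matrix.toEuclideanLin N (x₂ t))) (θ t)
        + Matrix.toEuclideanLin K (xhat₂ t - x₂ t)) t)
    (hθ : ∀ t ≥ (0:ℝ), HasDerivAt θ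
      (Matrix.toEuclideanLin
        (Λ * (MMat (η t - Matrix.toEuclideanLin N (x₂ t)))ᵀ * P) (xhat₂ t - x₂ t)) t) :
    ExpDecay (fun t => xhat₂ t - x₂ t) ∧
    ExpDecay (fun t =>
        (-(Matrix.toEuclideanLin (MMat (η t - Matrix.toEuclideanLin N (x₂ t))) (θ t)))
          - (-(Matrix.toEuclideanLin (Γ * T⁻¹) (ϱ t)))) ∧
    ExpDecay (fun t => θ t - CVec (Γ * T⁻¹)) := by
  obtain ⟨Cϱ, hCϱ⟩ := hϱbdd
  set Ψ := Γ * T⁻¹ with hΨ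
  have hΨblk : IsBlkRow Ψ := hΓblk.mul (hTblk.inv hT)
  have hTT : T * T⁻¹ = 1 := Matrix.mul_nonsing_inv T ((Matrix.isUnit_iff_isUnit_det T).1 hT)
  have hNΨ : N * Ψ = T * Φ * T⁻¹ - M := by
    rw [hΨ, ← Matrix.mul_assoc, ← hSyl, Matrix.sub_mul, Matrix.mul_assoc M, hTT, Matrix.mul_one]
  let ϱhat : ℝ → EuclideanSpace ℝ (BIdx r) := fun t => η t - Matrix.toEuclideanLin N (x₂ t)
  let ε : ℝ → EuclideanSpace ℝ (BIdx r) := fun t => ϱhat t - ϱ t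
  have hε : ExpDecay ε := by
    refine hM.expDecay ((eventually_ge_atTop 0).mono fun t ht => ?_)
    have h1 := (Matrix.toEuclideanLin N).toContinuousLinearMap.hasFDerivAt.comp_hasDerivAt t
      (hx₂ t ht)
    refine (((hη t ht).sub h1).sub (hϱ t ht)).congr_deriv ?_
    have h2 : Matrix.toEuclideanLin N (Matrix.toEuclideanLin Ψ (ϱ t)) =
        Matrix.toEuclideanLin (T * Φ * T⁻¹) (ϱ t) - Matrix.toEuclideanLin M (ϱ t) := by
      rw [← toEuclideanLin_mul, hNΨ, map_sub, LinearMap.sub_apply]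
    simp only [LinearMap.coe_toContinuousLinearMap', ε, ϱhat, map_sub, h2, toEuclideanLin_mul M N]
    abel
  obtain ⟨aR, haR, BQ, Q, R, hQR⟩ := exists_strictification_of_isPEVec
    (fun t ht => (hϱ t ht).continuousAt.continuousWithinAt) (fun t ht => (hCϱ t ht).1) hPE
  obtain ⟨cP, hcP, hPc⟩ := hP.exists_mul_norm_sq_le_inner
  obtain ⟨cA, hcA, hAc⟩ := hΛ.inv.exists_mul_norm_sq_le_inner
  let Pc := (Matrix.toEuclideanLin P).toContinuousLinearMap
  let Kc := (Matrix.toEuclideanLin K).toContinuousLinearMap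
  let Ac := (Matrix.toEuclideanLin Λ⁻¹).toContinuousLinearMap
  let Λc := (Matrix.toEuclideanLin Λ).toContinuousLinearMap
  let Mc := MMatCLM r
  let m := fun t => Mc (ϱ t)
  let m' := fun t => Mc (Matrix.toEuclideanLin (T * Φ * T⁻¹) (ϱ t))
  let φ := fun t => Mc (ϱhat t)
  let ψ := fun t => ContinuousLinearMap.adjoint (φ t)
  let θerr : ℝ → EuclideanSpace ℝ (BIdx r) := fun t => θ t - CVec Ψ
  let d : ℝ → EuclideanSpace ℝ (Fin n₂) := fun t => -Mc (ε t) (CVec Ψ)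
  obtain ⟨cε, hcε, lam, hlam, Tε, hTε⟩ := id hε
  have hε1 : ∀ᶠ t in atTop, ‖ε t‖ ≤ 1 := by
    have := hε.tendsto_zero.norm
    rw [norm_zero] at this
    exact this.eventually_le_const one_pos
  have hCϱ0 : 0 ≤ Cϱ := (norm_nonneg _).trans (hCϱ 0 le_rfl).1
  obtain ⟨B, hB⟩ : ∃ B, B = 1 + ‖Pc‖ + ‖Kc‖ + ‖Ac‖ + ‖Λc‖ + |BQ| + ‖Mc‖ * (Cϱ + 1) := ⟨_, rfl⟩
  have hB0 : 0 ≤ ‖Mc‖ * (Cϱ + 1) := by positivity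
  have hBb : 1 ≤ B ∧ ‖Pc‖ ≤ B ∧ ‖Kc‖ ≤ B ∧ ‖Ac‖ ≤ B ∧ ‖Λc‖ ≤ B ∧ BQ ≤ B ∧
      ‖Mc‖ * (Cϱ + 1) ≤ B := by
    have h1 := norm_nonneg Pc
    have h2 := norm_nonneg Kc
    have h3 := norm_nonneg Ac
    have h4 := norm_nonneg Λc
    have h5 := abs_nonneg BQ
    have h6 := le_abs_self BQ
    refine ⟨?_, ?_, ?_, ?_, ?_, ?_, ?_⟩ <;> linarith
  obtain ⟨hB1, hPB, hKB, hAB, hΛB, hQB, hMB⟩ := hBb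
  have hφB : ∀ᶠ t in atTop, ‖φ t‖ ≤ B := by
    filter_upwards [eventually_ge_atTop 0, hε1] with t ht h1
    refine (Mc.le_opNorm_of_le ?_).trans hMB
    have h2 : ϱhat t = ϱ t + ε t := by simp [ε]
    rw [h2]
    exact (norm_add_le _ _).trans (add_le_add (hCϱ t ht).1 h1)
  have hsymmP : ∀ u v, inner ℝ (Pc u) v = inner ℝ u (Pc v) := fun u v => by
    have := inner_toEuclideanLin_transpose P u v
    rwa [hPsymm.eq] at this
  have hsymmA : ∀ u v, inner ℝ (Ac u) v = inner ℝ u (Ac v) := fun u v => by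
    have := inner_toEuclideanLin_transpose Λ⁻¹ u v
    rwa [Matrix.transpose_nonsing_inv, hΛsymm.eq] at this
  have hAΛ : ∀ v, Ac (Λc v) = v := fun v => by
    change Matrix.toEuclideanLin Λ⁻¹ (Matrix.toEuclideanLin Λ v) = v
    rw [← toEuclideanLin_mul, Matrix.nonsing_inv_mul Λ hΛ.det_pos.ne'.isUnit]
    simp
  have hPKc : ∀ u, 2 * inner ℝ (Pc u) (Kc u) = -‖u‖ ^ 2 := fun u => by
    have h1 : inner ℝ u (Matrix.toEuclideanLin (Kᵀ * P + P * K) u) =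
        2 * inner ℝ (Pc u) (Kc u) := by
      rw [map_add, LinearMap.add_apply, inner_add_right, toEuclideanLin_mul, toEuclideanLin_mul,
        ← real_inner_comm, inner_toEuclideanLin_transpose, two_mul]
      congr 1
      exact (hsymmP u (Kc u)).symm
    rw [← h1, hKP, map_neg, LinearMap.neg_apply, inner_neg_right]
    simp
  have hψeq : ∀ t u, ψ t u = Matrix.toEuclideanLin (MMat (ϱhat t))ᵀ u := fun t u =>
    ext_inner_right ℝ fun v => by
      rw [inner_toEuclideanLin_transpose, ContinuousLinearMap.adjoint_inner_left]
      rfl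
  have hΨφ : ∀ t, Matrix.toEuclideanLin Ψ (ϱ t) = φ t (CVec Ψ) + d t := fun t => by
    rw [hΨblk.toEuclideanLin_eq, ← MMatCLM_apply]
    simp [φ, d, ε, Mc]
  have hmain := expDecay_of_adaptive_error_dynamics (P := Pc) (K := Kc) (A := Ac) (Λ := Λc)
    (x := fun t => xhat₂ t - x₂ t) (d := d) (θ := θerr) (φ := φ) (m := m) (m' := m') (ψ := ψ)
    (Q := Q) (R := R) (a := aR) (c := min cP cA) (B := B) (C := ‖Mc‖ * cε * (1 + ‖CVec Ψ‖))
    (lam := lam) haR (lt_min hcP hcA) (by positivity) hlam hsymmP hsymmA hPKc hAΛ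
    (fun u => (mul_le_mul_of_nonneg_right (min_le_left _ _) (sq_nonneg _)).trans (hPc u))
    (fun v => (mul_le_mul_of_nonneg_right (min_le_right _ _) (sq_nonneg _)).trans (hAc v))
    hPB hKB hAB hΛB hB1 (fun t u v => ContinuousLinearMap.adjoint_inner_left _ _ _)
    ?_ ?_ ?_ ?_ ?_ ?_ ?_ ?_ ?_ ?_ ?_
  · refine ⟨hmain.1, ?_, hmain.2⟩
    have h1 : ExpDecay fun t => -(φ t (θerr t)) :=
      hmain.2.of_eventually_norm_le (hφB.mono fun t ht => by
        rw [norm_neg]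
        exact (φ t).le_of_opNorm_le ht _)
    have h2 : ExpDecay d :=
      hε.of_eventually_norm_le (C := ‖Mc‖ * ‖CVec Ψ‖) (.of_forall fun t => by
        rw [norm_neg]
        exact (Mc.le_opNorm₂ _ _).trans (le_of_eq (by ring)))
    convert h1.add h2 using 2 with t
    · rfl
    rw [hΨφ, ← MMatCLM_apply]
    simp only [θerr, φ, map_sub, Mc, ϱhat]
    abel
  · filter_upwards [eventually_ge_atTop 0] with t ht
    exact (Mc.le_opNorm_of_le ((hCϱ t ht).1.trans (by linarith))).trans hMB
  · filter_upwards [eventually_ge_atTop 0] with t ht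
    exact (Mc.le_opNorm_of_le ((hCϱ t ht).2.trans (by linarith))).trans hMB
  · filter_upwards [hφB] with t ht
    rwa [LinearIsometryEquiv.norm_map]
  · filter_upwards [eventually_gt_atTop 0] with t ht
    exact (hQR t ht).2.1.trans hQB
  · filter_upwards [eventually_ge_atTop Tε] with t ht
    have h1 : φ t - m t = Mc (ε t) := (map_sub Mc _ _).symm
    rw [h1]
    refine (Mc.le_opNorm_of_le (hTε t ht)).trans ?_
    have : 0 ≤ ‖Mc‖ * cε * ‖CVec Ψ‖ * Real.exp (-lam * t) := by positivity
    linarith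
  · filter_upwards [eventually_ge_atTop Tε] with t ht
    rw [norm_neg]
    refine (Mc.le_opNorm₂ _ _).trans ?_
    have h1 : ‖Mc‖ * ‖ε t‖ * ‖CVec Ψ‖ ≤ ‖Mc‖ * (cε * Real.exp (-lam * t)) * ‖CVec Ψ‖ := by
      gcongr
      exact hTε t ht
    have : 0 ≤ ‖Mc‖ * cε * Real.exp (-lam * t) := by positivity
    linarith
  · filter_upwards [eventually_ge_atTop 0] with t ht
    exact Mc.hasFDerivAt.comp_hasDerivAt t (hϱ t ht)
  · filter_upwards [eventually_gt_atTop 0] with t ht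
    exact (hQR t ht).1
  · filter_upwards [eventually_gt_atTop 0] with t ht
    exact (hQR t ht).2.2
  · filter_upwards [eventually_ge_atTop 0] with t ht
    refine ((hxhat₂ t ht).sub (hx₂ t ht)).congr_deriv ?_
    rw [hΨφ, ← MMatCLM_apply]
    simp only [θerr, φ, map_sub, Mc, ϱhat, Kc, LinearMap.coe_toContinuousLinearMap']
    abel
  · filter_upwards [eventually_ge_atTop 0] with t ht
    refine ((hθ t ht).sub_const (CVec Ψ)).congr_deriv ?_
    rw [hψeq, toEuclideanLin_mul, toEuclideanLin_mul]
    rfl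
end
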